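/- For every real a > 1 and every integer N ≥ 1, one has (∑_{a^x < p ≤ a^{x+1}} 1/p) − ∑_{n=1}^{N} (−1)^{n−1}/(n·x^n) ∼ (−1)^N/((N+1)·x^{N+1}) as x → ∞, where the first sum is over primes p with a^x < p ≤ a^{x+1}; that is, ∑_{a^x < p ≤ a^{x+1}} 1/p has the asymptotic expansion ∑_{n=1}^∞ (−1)^{n−1}/(n·x^n) as x → ∞, independent of a. -/

import Mathlib

open Filter

open scoped Classical in
/-- `primeSumIoc l u = ∑_{l < p ≤ u} 1/p`, the sum over primes `p` with `l < p ≤ u`. -/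
noncomputable def primeSumIoc (l u : ℝ) : ℝ :=
  ∑ p ∈ (Finset.range (⌊u⌋₊ + 1)).filter (fun p => Nat.Prime p ∧ l < (p : ℝ) ∧ (p : ℝ) ≤ u),
    1 / (p : ℝ)

/-- `(s - 1) (m^{-s} - ∫_m^{m+1} x^{-s} dx)` with `m = n + 1`, written as an entire function. -/
noncomputable def zetaTerm (n : ℕ) (s : ℂ) : ℂ :=
  (s - 1) * ((n + 1 : ℝ) : ℂ) ^ (-s) + ((n + 2 : ℝ) : ℂ) ^ (1 - s) - ((n + 1 : ℝ) : ℂ) ^ (1 - s)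

lemma differentiable_zetaTerm (n : ℕ) : Differentiable ℂ (zetaTerm n) := by
  have h1 : ((n + 1 : ℝ) : ℂ) ≠ 0 := by
    have : (n + 1 : ℝ) ≠ 0 := by positivity
    exact_mod_cast this
  have h2 : ((n + 2 : ℝ) : ℂ) ≠ 0 := by
    have : (n + 2 : ℝ) ≠ 0 := by positivity
    exact_mod_cast this
  unfold zetaTerm
  refine Differentiable.sub (Differentiable.add (Differentiable.mul (by fun_prop) ?_) ?_) ?_
  · exact Differentiable.const_cpow (by fun_prop) (Or.inl h1)
  · exact Differentiable.const_cpow (by fun_prop) (Or.inl h2)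
  · exact Differentiable.const_cpow (by fun_prop) (Or.inl h1)

lemma zetaTerm_eq (n : ℕ) {s : ℂ} (hs : s ≠ 1) :
    zetaTerm n s = (s - 1) * ∫ x in (n + 1 : ℝ)..(n + 2),
      (((n + 1 : ℝ) : ℂ) ^ (-s) - (x : ℂ) ^ (-s)) := by
  have h0 : (0 : ℝ) ∉ Set.uIcc (n + 1 : ℝ) (n + 2) := by
    rw [Set.uIcc_of_le (by linarith)]
    intro h
    have := h.1
    have : (0 : ℝ) ≤ n := n.cast_nonneg
    linarith
  have hi : IntervalIntegrable (fun x : ℝ => (x : ℂ) ^ (-s)) MeasureTheory.volume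
      (n + 1 : ℝ) (n + 2) := intervalIntegral.intervalIntegrable_cpow (Or.inr h0)
  rw [intervalIntegral.integral_sub (by simp) hi, intervalIntegral.integral_const,
    integral_cpow (Or.inr ⟨fun h => hs (by linear_combination -h), h0⟩)]
  have h1 : -s + 1 ≠ 0 := fun h => hs (by linear_combination -h)
  have h2 : 1 - s ≠ 0 := fun h => hs (by linear_combination -h)
  rw [show -s + 1 = 1 - s by ring, zetaTerm]
  rw [show ((n : ℝ) + 2 - (n + 1)) = 1 by ring]
  field_simp
  simp
  ring

lemma norm_ofReal_cpow_neg_sub_le {m x θ : ℝ} {s : ℂ} (hm : 1 ≤ m) (hx : m ≤ x) (hx' : x ≤ m + 1)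
    (hs : 0 ≤ s.re) (hθ : 0 ≤ θ) (hθ' : θ ≤ 1) :
    ‖(m : ℂ) ^ (-s) - (x : ℂ) ^ (-s)‖ ≤ 2 * (‖s‖ ^ θ * m ^ (-s.re - θ)) := by
  have hm0 : 0 < m := by linarith
  have hA : ‖(m : ℂ) ^ (-s) - (x : ℂ) ^ (-s)‖ ≤ 2 * m ^ (-s.re) := by
    refine (norm_sub_le _ _).trans ?_
    rw [Complex.norm_cpow_eq_rpow_re_of_pos hm0, Complex.norm_cpow_eq_rpow_re_of_pos (by linarith),
      Complex.neg_re]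
    have := Real.rpow_le_rpow_of_nonpos hm0 hx (show -s.re ≤ 0 by linarith)
    linarith
  have hB : ‖(m : ℂ) ^ (-s) - (x : ℂ) ^ (-s)‖ ≤ ‖s‖ * m ^ (-s.re - 1) := by
    rcases eq_or_ne s 0 with rfl | hs0
    · simp
    have hd : ∀ y ∈ Set.Icc m (m + 1), HasDerivWithinAt (fun y : ℝ => (y : ℂ) ^ (-s))
        (-s * (y : ℂ) ^ (-s - 1)) (Set.Icc m (m + 1)) y := by
      intro y hy
      exact (hasDerivAt_ofReal_cpow_const (by linarith [hy.1]) (by simpa using hs0)).hasDerivWithinAt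
    have hb : ∀ y ∈ Set.Icc m (m + 1), ‖-s * (y : ℂ) ^ (-s - 1)‖ ≤ ‖s‖ * m ^ (-s.re - 1) := by
      intro y hy
      rw [norm_mul, norm_neg, Complex.norm_cpow_eq_rpow_re_of_pos (by linarith [hy.1])]
      simp only [Complex.sub_re, Complex.neg_re, Complex.one_re]
      gcongr ‖s‖ * ?_
      exact Real.rpow_le_rpow_of_nonpos hm0 hy.1 (by linarith)
    have := (convex_Icc m (m + 1)).norm_image_sub_le_of_norm_hasDerivWithin_le hd hb
      (x := x) (y := m) ⟨hx, hx'⟩ ⟨le_rfl, by linarith⟩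
    refine this.trans (mul_le_of_le_one_right (by positivity) ?_)
    rw [Real.norm_eq_abs, abs_le]
    constructor <;> linarith
  have hq : ‖s‖ ^ θ * m ^ (-s.re - θ) = m ^ (-s.re) * (‖s‖ / m) ^ θ := by
    rw [Real.div_rpow (norm_nonneg _) hm0.le, Real.rpow_sub hm0]
    ring
  rw [hq]
  rcases le_total ‖s‖ m with h | h
  · refine hB.trans ?_
    have : (‖s‖ / m) ≤ (‖s‖ / m) ^ θ :=
      Real.self_le_rpow_of_le_one (by positivity) ((div_le_one hm0).2 h) hθ'
    calc ‖s‖ * m ^ (-s.re - 1) = m ^ (-s.re) * (‖s‖ / m) := by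
          rw [Real.rpow_sub hm0, Real.rpow_one]; ring
      _ ≤ m ^ (-s.re) * (‖s‖ / m) ^ θ := by gcongr
      _ ≤ 2 * (m ^ (-s.re) * (‖s‖ / m) ^ θ) := by
          have : 0 ≤ m ^ (-s.re) * (‖s‖ / m) ^ θ := by positivity
          linarith
  · refine hA.trans ?_
    have : 1 ≤ (‖s‖ / m) ^ θ := Real.one_le_rpow ((one_le_div hm0).2 h) hθ
    gcongr
    exact le_mul_of_one_le_right (by positivity) this

lemma norm_zetaTerm_le (n : ℕ) {s : ℂ} {θ : ℝ} (hs : 0 ≤ s.re) (hθ : 0 ≤ θ) (hθ' : θ ≤ 1) :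
    ‖zetaTerm n s‖ ≤ ‖s - 1‖ * (2 * (‖s‖ ^ θ * (n + 1 : ℝ) ^ (-s.re - θ))) := by
  rcases eq_or_ne s 1 with rfl | h1
  · simp [zetaTerm]
  rw [zetaTerm_eq n h1, norm_mul]
  gcongr
  have := intervalIntegral.norm_integral_le_of_norm_le_const
    (a := (n + 1 : ℝ)) (b := n + 2) (C := 2 * (‖s‖ ^ θ * (n + 1 : ℝ) ^ (-s.re - θ)))
    (f := fun x : ℝ => ((n + 1 : ℝ) : ℂ) ^ (-s) - (x : ℂ) ^ (-s)) (by
      intro x hx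
      rw [Set.uIoc_of_le (by linarith)] at hx
      refine norm_ofReal_cpow_neg_sub_le ?_ hx.1.le (by linarith [hx.2]) hs hθ hθ'
      have : (0 : ℝ) ≤ n := n.cast_nonneg
      linarith)
  refine this.trans (le_of_eq ?_)
  rw [show ((n : ℝ) + 2 - (n + 1)) = 1 by ring]
  simp

lemma summable_add_one_rpow_neg {r : ℝ} (hr : 1 < r) :
    Summable (fun n : ℕ => (n + 1 : ℝ) ^ (-r)) := by
  have := (summable_nat_add_iff 1).2 (Real.summable_nat_rpow.2 (show -r < -1 by linarith))
  simpa using this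

lemma tsum_zetaTerm_of_one_lt_re {s : ℂ} (hs : 1 < s.re) :
    1 + ∑' n, zetaTerm n s = (s - 1) * riemannZeta s := by
  have hz : HasSum (fun n : ℕ => (s - 1) * ((n + 1 : ℝ) : ℂ) ^ (-s)) ((s - 1) * riemannZeta s) := by
    refine HasSum.mul_left _ ?_
    rw [zeta_eq_tsum_one_div_nat_add_one_cpow hs]
    have hsum : Summable (fun n : ℕ => 1 / ((n : ℂ) + 1) ^ s) := by
      have := (summable_nat_add_iff 1).2 (Complex.summable_one_div_nat_cpow.2 hs)
      simpa using this
    refine hsum.hasSum.congr_fun fun n => ?_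
    simp [Complex.cpow_neg]
  have ht : HasSum (fun n : ℕ => zetaTerm n s) ((s - 1) * riemannZeta s - 1) := by
    have hsum : Summable (fun n : ℕ => zetaTerm n s) := by
      refine Summable.of_norm_bounded (g := fun n : ℕ => ‖s - 1‖ * (2 * (‖s‖ ^ (0 : ℝ) *
        (n + 1 : ℝ) ^ (-s.re - 0)))) ?_ (fun n => norm_zetaTerm_le n (by linarith) le_rfl zero_le_one)
      simp only [sub_zero]
      exact ((((summable_add_one_rpow_neg hs).mul_left _).mul_left _).mul_left _)
    have h1 := hsum.hasSum.tendsto_sum_nat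
    have hpart : ∀ N : ℕ, ∑ n ∈ Finset.range N, zetaTerm n s =
        (∑ n ∈ Finset.range N, (s - 1) * ((n + 1 : ℝ) : ℂ) ^ (-s)) +
          (((N + 1 : ℝ) : ℂ) ^ (1 - s) - 1) := by
      intro N
      induction N with
      | zero => simp
      | succ N ih =>
        rw [Finset.sum_range_succ, ih, Finset.sum_range_succ, zetaTerm]
        push_cast
        ring_nf
    have h2 : Tendsto (fun N : ℕ => (((N + 1 : ℝ) : ℂ) ^ (1 - s) - 1)) atTop (nhds (0 - 1)) := by
      refine Tendsto.sub_const ?_ _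
      rw [tendsto_zero_iff_norm_tendsto_zero]
      have h3 : Tendsto (fun N : ℕ => (N + 1 : ℝ) ^ (-(s.re - 1))) atTop (nhds 0) :=
        (tendsto_rpow_neg_atTop (by linarith)).comp
          (tendsto_atTop_add_const_right _ _ tendsto_natCast_atTop_atTop)
      refine h3.congr fun N => ?_
      rw [Complex.norm_cpow_eq_rpow_re_of_pos (by positivity)]
      simp
    have h4 := hz.tendsto_sum_nat.add h2
    simp_rw [← hpart] at h4
    have := tendsto_nhds_unique h1 h4
    rw [← show (s - 1) * riemannZeta s + (0 - 1) = (s - 1) * riemannZeta s - 1 by ring, ← this]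
    exact hsum.hasSum
  rw [ht.tsum_eq]
  ring

/-- The entire function `(s - 1) ζ(s)`. -/
noncomputable def zetaMulSub (s : ℂ) : ℂ := DirichletCharacter.LFunctionTrivChar₁ 1 s

lemma zetaMulSub_of_ne {s : ℂ} (hs : s ≠ 1) : zetaMulSub s = (s - 1) * riemannZeta s := by
  simp [zetaMulSub, DirichletCharacter.LFunctionTrivChar₁, Function.update_of_ne hs,
    DirichletCharacter.LFunctionTrivChar, DirichletCharacter.LFunction_modOne_eq]

lemma zetaMulSub_one : zetaMulSub 1 = 1 := by
  simp [zetaMulSub, DirichletCharacter.LFunctionTrivChar₁]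

lemma differentiable_zetaMulSub : Differentiable ℂ zetaMulSub :=
  DirichletCharacter.differentiable_LFunctionTrivChar₁ 1

lemma one_add_tsum_zetaTerm {s : ℂ} (hs : 1 / 2 ≤ s.re) :
    1 + ∑' n, zetaTerm n s = zetaMulSub s := by
  set R : ℝ := ‖s‖ + 3 with hR
  set U : Set ℂ := {z | 1 / 4 < z.re} ∩ Metric.ball 0 R with hU
  have hUo : IsOpen U := (isOpen_lt continuous_const Complex.continuous_re).inter Metric.isOpen_ball
  have hUc : IsPreconnected U :=
    ((convex_halfSpace_re_gt (1 / 4)).inter (convex_ball 0 R)).isPreconnected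
  have hd : DifferentiableOn ℂ (fun z => ∑' n, zetaTerm n z) U := by
    refine Complex.differentiableOn_tsum_of_summable_norm
      (u := fun n : ℕ => (R + 1) * (2 * (R * (n + 1 : ℝ) ^ (-(5 / 4 : ℝ))))) ?_
      (fun n => (differentiable_zetaTerm n).differentiableOn) hUo ?_
    · exact (((summable_add_one_rpow_neg (by norm_num)).mul_left _).mul_left _).mul_left _
    · intro n z hz
      have hz1 : 1 / 4 < z.re := hz.1
      have hz2 : ‖z‖ < R := by simpa using hz.2
      refine (norm_zetaTerm_le n (by linarith) zero_le_one le_rfl).trans ?_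
      have h1 : ‖z - 1‖ ≤ R + 1 := (norm_sub_le _ _).trans (by simp; linarith)
      rw [Real.rpow_one]
      have h2 : (n + 1 : ℝ) ^ (-z.re - 1) ≤ (n + 1 : ℝ) ^ (-(5 / 4 : ℝ)) :=
        Real.rpow_le_rpow_of_exponent_le (by linarith [n.cast_nonneg (α := ℝ)]) (by linarith)
      gcongr
  have hev : (fun z => 1 + ∑' n, zetaTerm n z) =ᶠ[nhds 2] zetaMulSub := by
    have : ∀ᶠ z : ℂ in nhds 2, 1 < z.re :=
      (isOpen_lt continuous_const Complex.continuous_re).mem_nhds (by simp)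
    filter_upwards [this] with z hz
    rw [tsum_zetaTerm_of_one_lt_re hz, zetaMulSub_of_ne]
    rintro rfl
    simp at hz
  have hmem : (2 : ℂ) ∈ U := by
    refine ⟨by norm_num, ?_⟩
    simp only [Metric.mem_ball, dist_zero_right, Complex.norm_ofNat]
    linarith [norm_nonneg s]
  exact AnalyticOnNhd.eqOn_of_preconnected_of_eventuallyEq
    ((hd.const_add 1).analyticOnNhd hUo)
    (differentiable_zetaMulSub.differentiableOn.analyticOnNhd hUo) hUc hmem hev
    (show s ∈ U from ⟨by simp only [Set.mem_ofPred_eq]; linarith, by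
      simp only [Metric.mem_ball, dist_zero_right]; linarith⟩)

lemma exists_norm_zetaMulSub_sub_one_le {θ : ℝ} (hθ : 0 < θ) (hθ' : θ ≤ 1) :
    ∃ C : ℝ, 0 < C ∧ ∀ s : ℂ, 1 - θ / 2 ≤ s.re → ‖zetaMulSub s - 1‖ ≤ C * (‖s - 1‖ * ‖s‖ ^ θ) := by
  have hsum := summable_add_one_rpow_neg (show 1 < 1 + θ / 2 by linarith)
  refine ⟨2 * ∑' n : ℕ, (n + 1 : ℝ) ^ (-(1 + θ / 2)), ?_, fun s hs => ?_⟩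
  · have := hsum.tsum_pos (fun n => by positivity) 0 (by simp)
    linarith
  have hle : ∀ n : ℕ, ‖zetaTerm n s‖ ≤
      (2 * (‖s - 1‖ * ‖s‖ ^ θ)) * (n + 1 : ℝ) ^ (-(1 + θ / 2)) := by
    intro n
    refine (norm_zetaTerm_le n (by linarith) hθ.le hθ').trans ?_
    have h2 : (n + 1 : ℝ) ^ (-s.re - θ) ≤ (n + 1 : ℝ) ^ (-(1 + θ / 2)) :=
      Real.rpow_le_rpow_of_exponent_le (by linarith [n.cast_nonneg (α := ℝ)]) (by linarith)
    calc _ ≤ ‖s - 1‖ * (2 * (‖s‖ ^ θ * (n + 1 : ℝ) ^ (-(1 + θ / 2)))) := by gcongr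
      _ = _ := by ring
  rw [← one_add_tsum_zetaTerm (by linarith), add_sub_cancel_left]
  refine (tsum_of_norm_bounded (hsum.mul_left _).hasSum hle).trans (le_of_eq ?_)
  rw [tsum_mul_left]
  ring

/-- Subpolynomial growth of `ζ` slightly to the left of the line `Re s = 1`. -/
lemma exists_norm_riemannZeta_le {θ : ℝ} (hθ : 0 < θ) (hθ' : θ ≤ 1) :
    ∃ C : ℝ, 1 ≤ C ∧ ∀ s : ℂ, 1 - θ / 2 ≤ s.re → s.re ≤ 5 → 1 ≤ |s.im| →
      ‖riemannZeta s‖ ≤ C * |s.im| ^ θ := by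
  obtain ⟨C, hC0, hC⟩ := exists_norm_zetaMulSub_sub_one_le hθ hθ'
  refine ⟨6 * C + 1, by linarith, fun s h1 h2 h3 => ?_⟩
  have hs1 : s ≠ 1 := by rintro rfl; norm_num at h3
  have hsub : 1 ≤ ‖s - 1‖ := by
    have := Complex.abs_im_le_norm (s - 1)
    simp at this
    linarith
  have hns : ‖s‖ ≤ 6 * |s.im| := by
    have := Complex.norm_le_abs_re_add_abs_im s
    have h4 : |s.re| ≤ 5 := abs_le.2 ⟨by linarith, h2⟩
    linarith
  have hpow : ‖s‖ ^ θ ≤ 6 * |s.im| ^ θ := by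
    calc ‖s‖ ^ θ ≤ (6 * |s.im|) ^ θ := by gcongr
      _ = 6 ^ θ * |s.im| ^ θ := Real.mul_rpow (by norm_num) (abs_nonneg _)
      _ ≤ 6 * |s.im| ^ θ := by
        gcongr
        calc (6 : ℝ) ^ θ ≤ 6 ^ (1 : ℝ) := Real.rpow_le_rpow_of_exponent_le (by norm_num) hθ'
          _ = 6 := by simp
  have hT : 1 ≤ |s.im| ^ θ := Real.one_le_rpow h3 hθ.le
  have h5 := hC s h1
  rw [zetaMulSub_of_ne hs1] at h5
  have h6 : ‖s - 1‖ * ‖riemannZeta s‖ ≤ ‖s - 1‖ * ((6 * C + 1) * |s.im| ^ θ) := by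
    rw [← norm_mul]
    calc ‖(s - 1) * riemannZeta s‖ ≤ ‖(s - 1) * riemannZeta s - 1‖ + ‖(1 : ℂ)‖ := by
          simpa using norm_add_le ((s - 1) * riemannZeta s - 1) 1
      _ ≤ C * (‖s - 1‖ * (6 * |s.im| ^ θ)) + 1 := by
          rw [norm_one]
          gcongr
          exact h5.trans (by gcongr)
      _ ≤ _ := by nlinarith
  exact le_of_mul_le_mul_left h6 (by linarith)

lemma abs_im_sub_le_of_mem_closedBall {s w : ℂ} {r : ℝ} (hw : w ∈ Metric.closedBall s r) :
    s.re - r ≤ w.re ∧ w.re ≤ s.re + r ∧ |s.im| - r ≤ |w.im| ∧ |w.im| ≤ |s.im| + r := by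
  rw [Metric.mem_closedBall, dist_eq_norm] at hw
  have h1 := abs_le.1 ((Complex.abs_re_le_norm (w - s)).trans hw)
  have h2 := (Complex.abs_im_le_norm (w - s)).trans hw
  simp only [Complex.sub_re, Complex.sub_im] at h1 h2
  have h3 := abs_sub_abs_le_abs_sub w.im s.im
  have h4 := abs_sub_abs_le_abs_sub s.im w.im
  rw [abs_sub_comm] at h4
  refine ⟨?_, ?_, ?_, ?_⟩ <;> linarith [h1.1, h1.2]

lemma rpow_le_two_mul_rpow {x y θ : ℝ} (hx : 0 ≤ x) (hxy : x ≤ 2 * y) (hθ : 0 ≤ θ) (hθ' : θ ≤ 1) :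
    x ^ θ ≤ 2 * y ^ θ := by
  have hy : 0 ≤ y := by linarith
  calc x ^ θ ≤ (2 * y) ^ θ := by gcongr
    _ = 2 ^ θ * y ^ θ := Real.mul_rpow (by norm_num) hy
    _ ≤ 2 * y ^ θ := by
      gcongr
      calc (2 : ℝ) ^ θ ≤ 2 ^ (1 : ℝ) := Real.rpow_le_rpow_of_exponent_le (by norm_num) hθ'
        _ = 2 := by simp

lemma exists_norm_deriv_riemannZeta_le {θ : ℝ} (hθ : 0 < θ) (hθ' : θ ≤ 1) :
    ∃ C : ℝ, 1 ≤ C ∧ ∀ s : ℂ, 1 - θ / 4 ≤ s.re → s.re ≤ 4 → 2 ≤ |s.im| →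
      ‖deriv riemannZeta s‖ ≤ C * |s.im| ^ θ := by
  obtain ⟨C, hC1, hC⟩ := exists_norm_riemannZeta_le hθ hθ'
  refine ⟨8 * C / θ, ?_, fun s h1 h2 h3 => ?_⟩
  · rw [one_le_div hθ]; linarith
  have hr : 0 < θ / 4 := by linarith
  have hne : ∀ w ∈ Metric.closedBall s (θ / 4), w ≠ 1 := by
    rintro w hw rfl
    have := (abs_im_sub_le_of_mem_closedBall hw).2.2.1
    norm_num at this
    linarith
  have hd : DiffContOnCl ℂ riemannZeta (Metric.ball s (θ / 4)) := by
    refine DifferentiableOn.diffContOnCl fun w hw => ?_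
    rw [closure_ball _ hr.ne'] at hw
    exact (differentiableAt_riemannZeta (hne w hw)).differentiableWithinAt
  have := Complex.norm_deriv_le_of_forall_mem_sphere_norm_le hr hd
    (C := C * (2 * |s.im| ^ θ)) (fun w hw => by
      have hw' := abs_im_sub_le_of_mem_closedBall (Metric.sphere_subset_closedBall hw)
      refine (hC w (by linarith) (by linarith) (by linarith)).trans ?_
      gcongr
      exact rpow_le_two_mul_rpow (abs_nonneg _) (by linarith) hθ.le hθ')
  refine this.trans (le_of_eq ?_)
  field_simp
  ring

lemma one_le_norm_riemannZeta_product {x : ℝ} (hx : 0 < x) (y : ℝ) :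
    1 ≤ ‖riemannZeta (1 + x)‖ ^ 3 * ‖riemannZeta (1 + x + Complex.I * y)‖ ^ 4 *
      ‖riemannZeta (1 + x + 2 * Complex.I * y)‖ := by
  have := DirichletCharacter.norm_LFunction_product_ge_one (N := 1) 1 hx y
  simpa [DirichletCharacter.LFunctionTrivChar, DirichletCharacter.LFunction_modOne_eq] using this

lemma exists_norm_riemannZeta_one_add_le :
    ∃ C : ℝ, 1 ≤ C ∧ ∀ x : ℝ, 0 < x → x ≤ 4 → ‖riemannZeta (1 + x)‖ ≤ C / x := by
  obtain ⟨C, hC0, hC⟩ := exists_norm_zetaMulSub_sub_one_le one_pos le_rfl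
  refine ⟨20 * C + 1, by linarith, fun x hx hx4 => ?_⟩
  have hne : (1 + x : ℂ) ≠ 1 := by simpa using hx.ne'
  have h := hC (1 + x) (by simp; linarith)
  have hn : ‖(1 + x : ℂ)‖ = 1 + x := by
    rw [← Complex.ofReal_one, ← Complex.ofReal_add, Complex.norm_real, Real.norm_eq_abs,
      abs_of_pos (by linarith)]
  rw [zetaMulSub_of_ne hne, Real.rpow_one, hn, add_sub_cancel_left, Complex.norm_real,
    Real.norm_eq_abs, abs_of_pos hx] at h
  rw [le_div_iff₀ hx]
  have h2 : ‖(x : ℂ) * riemannZeta (1 + x)‖ ≤ C * (x * (1 + x)) + 1 := by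
    calc _ ≤ ‖(x : ℂ) * riemannZeta (1 + x) - 1‖ + ‖(1 : ℂ)‖ := by
          simpa using norm_add_le ((x : ℂ) * riemannZeta (1 + x) - 1) 1
      _ ≤ _ := by rw [norm_one]; gcongr
  rw [norm_mul, Complex.norm_real, Real.norm_eq_abs, abs_of_pos hx] at h2
  nlinarith [mul_le_mul hx4 (show 1 + x ≤ 5 by linarith) (by linarith) (by norm_num)]

lemma exists_le_norm_riemannZeta_pow_four {θ : ℝ} (hθ : 0 < θ) (hθ' : θ ≤ 1) :
    ∃ c : ℝ, 0 < c ∧ ∀ s : ℂ, 1 < s.re → s.re ≤ 5 → 2 ≤ |s.im| →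
      c * ((s.re - 1) ^ 3 / |s.im| ^ θ) ≤ ‖riemannZeta s‖ ^ 4 := by
  obtain ⟨C, hC1, hC⟩ := exists_norm_riemannZeta_le hθ hθ'
  obtain ⟨D, hD1, hD⟩ := exists_norm_riemannZeta_one_add_le
  refine ⟨1 / (D ^ 3 * (2 * C)), by positivity, fun s h1 h2 h3 => ?_⟩
  set x := s.re - 1 with hxdef
  have hx : 0 < x := by linarith
  have hT : 0 < |s.im| ^ θ := Real.rpow_pos_of_pos (by linarith) _
  have hprod := one_le_norm_riemannZeta_product hx s.im
  have hs : (1 + x + Complex.I * s.im : ℂ) = s := by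
    apply Complex.ext <;> simp [hxdef]
  rw [hs] at hprod
  have hz1 := hD x hx (by linarith)
  have hz2 : ‖riemannZeta (1 + x + 2 * Complex.I * s.im)‖ ≤ C * (2 * |s.im| ^ θ) := by
    have him : (1 + x + 2 * Complex.I * s.im : ℂ).im = 2 * s.im := by simp
    have hre : (1 + x + 2 * Complex.I * s.im : ℂ).re = s.re := by simp [hxdef]
    refine (hC _ (by rw [hre]; linarith) (by rw [hre]; linarith) ?_).trans ?_
    · rw [him, abs_mul]; norm_num; linarith
    · gcongr
      refine rpow_le_two_mul_rpow (abs_nonneg _) ?_ hθ.le hθ'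
      rw [him, abs_mul]; norm_num
  have hmain : 1 ≤ (D / x) ^ 3 * ‖riemannZeta s‖ ^ 4 * (C * (2 * |s.im| ^ θ)) :=
    hprod.trans (by gcongr)
  have : 1 ≤ ‖riemannZeta s‖ ^ 4 * ((D ^ 3 * (2 * C)) * (|s.im| ^ θ / x ^ 3)) := by
    refine hmain.trans (le_of_eq ?_)
    field_simp
  rw [← div_le_iff₀ (by positivity)] at this
  refine le_trans (le_of_eq ?_) this
  field_simp

/-- A lower bound for `ζ` in a region slightly larger than the half-plane `Re s ≥ 1`. -/
lemma exists_le_norm_riemannZeta {θ : ℝ} (hθ : 0 < θ) (hθ' : θ ≤ 1) :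
    ∃ c : ℝ, 0 < c ∧ c ≤ θ / 4 ∧ ∀ s : ℂ, 1 - c / (|s.im| ^ θ) ^ 5 ≤ s.re → s.re ≤ 3 →
      2 ≤ |s.im| → c / (|s.im| ^ θ) ^ 4 ≤ ‖riemannZeta s‖ := by
  obtain ⟨C, hC1, hC⟩ := exists_norm_deriv_riemannZeta_le hθ hθ'
  obtain ⟨c, hc0, hc⟩ := exists_le_norm_riemannZeta_pow_four hθ hθ'
  set κ : ℝ := min (θ / 2) (c / (128 * C ^ 4)) with hκ
  have hκ0 : 0 < κ := lt_min (by linarith) (by positivity)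
  have hκ1 : κ ≤ θ / 2 := min_le_left _ _
  have hκ2 : 128 * C ^ 4 * κ ≤ c := by
    have := min_le_right (θ / 2) (c / (128 * C ^ 4))
    rw [← hκ, le_div_iff₀ (by positivity)] at this
    linarith
  refine ⟨κ / 2, by linarith, by linarith, fun s h1 h2 h3 => ?_⟩
  set T := |s.im| ^ θ with hTdef
  have hT1 : 1 ≤ T := Real.one_le_rpow (by linarith) hθ.le
  set η := κ / T ^ 5 with hη
  have hη0 : 0 < η := by positivity
  have hηκ : η ≤ κ := div_le_self hκ0.le (one_le_pow₀ hT1)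
  rw [show κ / 2 / T ^ 5 = η / 2 by rw [hη]; ring] at h1
  have hre : (s + η).re = s.re + η := by simp
  have him : (s + η).im = s.im := by simp
  have hlow : 2 * C * η * T ≤ ‖riemannZeta (s + η)‖ := by
    refine le_of_pow_le_pow_left₀ (n := 4) (by norm_num) (norm_nonneg _) ?_
    refine le_trans ?_ (hc (s + η) (by rw [hre]; linarith) (by rw [hre]; linarith)
      (by rw [him]; exact h3))
    rw [hre, him, ← hTdef]
    calc (2 * C * η * T) ^ 4 = (128 * C ^ 4 * κ) * ((η / 2) ^ 3 / T) := by
          rw [hη]; field_simp; ring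
      _ ≤ c * ((s.re + η - 1) ^ 3 / T) := by
          gcongr
          linarith
  have hdiff : ‖riemannZeta (s + η) - riemannZeta s‖ ≤ C * T * η := by
    have hconv : Convex ℝ {w : ℂ | s.re ≤ w.re ∧ w.re ≤ s.re + η ∧ w.im = s.im} := by
      have := (convex_halfSpace_re_ge s.re).inter ((convex_halfSpace_re_le (s.re + η)).inter
        ((convex_halfSpace_im_ge s.im).inter (convex_halfSpace_im_le s.im)))
      convert this using 1
      ext w
      simp only [Set.mem_inter_iff, Set.mem_ofPred_eq]
      constructor
      · rintro ⟨a, b, c⟩; exact ⟨a, b, c.ge, c.le⟩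
      · rintro ⟨a, b, c, d⟩; exact ⟨a, b, le_antisymm d c⟩
    have := hconv.norm_image_sub_le_of_norm_deriv_le (𝕜 := ℂ) (f := riemannZeta) (C := C * T)
      (x := s) (y := s + η) (fun w hw => differentiableAt_riemannZeta (by
        rintro rfl
        have := hw.2.2
        rw [← this] at h3
        norm_num at h3)) (fun w hw => by
        have := hC w (by linarith [hw.1]) (by linarith [hw.2.1]) (by rw [hw.2.2]; exact h3)
        rwa [hw.2.2] at this) ⟨le_rfl, by linarith, rfl⟩ ⟨by rw [hre]; linarith, hre.le, him⟩
    rwa [add_sub_cancel_left, Complex.norm_real, Real.norm_eq_abs, abs_of_pos hη0] at this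
  have hrev : ‖riemannZeta (s + η)‖ ≤ ‖riemannZeta (s + η) - riemannZeta s‖ + ‖riemannZeta s‖ := by
    simpa using norm_add_le (riemannZeta (s + η) - riemannZeta s) (riemannZeta s)
  have h5 : C * η * T ≤ ‖riemannZeta s‖ := by linarith
  refine le_trans ?_ h5
  have : C * η * T = C * (κ / T ^ 4) := by rw [hη]; field_simp
  rw [this]
  calc κ / 2 / T ^ 4 ≤ 1 * (κ / T ^ 4) := by
        rw [one_mul]; gcongr; linarith
    _ ≤ _ := by gcongr

/-- The coefficients `Λ(n) - 1`. -/
noncomputable def mangoldtSubOne (n : ℕ) : ℂ := (ArithmeticFunction.vonMangoldt n : ℂ) - 1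

lemma LSeriesSummable_mangoldtSubOne {s : ℂ} (hs : 1 < s.re) :
    LSeriesSummable mangoldtSubOne s :=
  (ArithmeticFunction.LSeriesSummable_vonMangoldt hs).sub (LSeriesSummable_one_iff.2 hs)

lemma abscissaOfAbsConv_mangoldtSubOne_lt {s : ℂ} (hs : 1 < s.re) :
    LSeries.abscissaOfAbsConv mangoldtSubOne < s.re := by
  refine lt_of_le_of_lt (b := ((1 : ℝ) : EReal)) ?_ (by exact_mod_cast hs)
  exact LSeries.abscissaOfAbsConv_le_of_forall_lt_LSeriesSummable fun y hy =>
    LSeriesSummable_mangoldtSubOne (by simpa using hy)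

lemma LSeries_mangoldtSubOne {s : ℂ} (hs : 1 < s.re) :
    LSeries mangoldtSubOne s = -deriv riemannZeta s / riemannZeta s - riemannZeta s := by
  rw [← ArithmeticFunction.LSeries_vonMangoldt_eq_deriv_riemannZeta_div hs,
    ← LSeries_one_eq_riemannZeta hs]
  exact LSeries_sub (ArithmeticFunction.LSeriesSummable_vonMangoldt hs)
    (LSeriesSummable_one_iff.2 hs)

lemma eventually_one_lt_re {s : ℂ} (hs : 1 < s.re) : ∀ᶠ z : ℂ in nhds s, 1 < z.re :=
  (isOpen_lt continuous_const Complex.continuous_re).mem_nhds hs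

lemma zetaMulSub_ne_zero {s : ℂ} (hs : 1 ≤ s.re) : zetaMulSub s ≠ 0 := by
  rcases eq_or_ne s 1 with rfl | h
  · simp [zetaMulSub_one]
  · rw [zetaMulSub_of_ne h]
    exact mul_ne_zero (sub_ne_zero.2 h) (riemannZeta_ne_zero_of_one_le_re hs)

lemma LSeries_mangoldtSubOne_eq_zetaMulSub {s : ℂ} (hs : 1 < s.re) :
    LSeries mangoldtSubOne s = -deriv zetaMulSub s / zetaMulSub s - dslope zetaMulSub 1 s := by
  have h1 : s ≠ 1 := by rintro rfl; simp at hs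
  have h1' : s - 1 ≠ 0 := sub_ne_zero.2 h1
  have hd : deriv zetaMulSub s = riemannZeta s + (s - 1) * deriv riemannZeta s := by
    have : zetaMulSub =ᶠ[nhds s] fun z => (z - 1) * riemannZeta z := by
      filter_upwards [isOpen_ne.mem_nhds h1] with z hz using zetaMulSub_of_ne hz
    rw [this.deriv_eq]
    have h2 := ((hasDerivAt_id s).sub_const 1).mul (differentiableAt_riemannZeta h1).hasDerivAt
    simpa using! h2.deriv
  have hz : riemannZeta s ≠ 0 := riemannZeta_ne_zero_of_one_lt_re hs
  rw [LSeries_mangoldtSubOne hs, dslope_of_ne _ h1, slope_def_field, hd, zetaMulSub_of_ne h1,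
    zetaMulSub_one]
  field_simp
  ring

lemma exists_norm_iteratedDeriv_mangoldtSubOne_le_of_im_le (j : ℕ) :
    ∃ C : ℝ, ∀ s : ℂ, 1 < s.re → s.re ≤ 2 → |s.im| ≤ 3 →
      ‖iteratedDeriv j (LSeries mangoldtSubOne) s‖ ≤ C := by
  set g : ℂ → ℂ := fun s => -deriv zetaMulSub s / zetaMulSub s - dslope zetaMulSub 1 s with hg
  set U : Set ℂ := {s | zetaMulSub s ≠ 0} with hU
  have hUo : IsOpen U := isOpen_ne_fun differentiable_zetaMulSub.continuous continuous_const
  have hgd : DifferentiableOn ℂ g U := by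
    have h1 : Differentiable ℂ (deriv zetaMulSub) := fun s =>
      (differentiable_zetaMulSub.analyticAt s).deriv.differentiableAt
    have h2 : DifferentiableOn ℂ (dslope zetaMulSub 1) Set.univ :=
      (Complex.differentiableOn_dslope Filter.univ_mem).2 differentiable_zetaMulSub.differentiableOn
    exact (h1.neg.differentiableOn.div differentiable_zetaMulSub.differentiableOn
      (fun s hs => hs)).sub (h2.mono (Set.subset_univ _))
  have hcont : ContinuousOn (iteratedDeriv j g) U := by
    rw [iteratedDeriv_eq_iterate]
    exact ((hgd.analyticOnNhd hUo).iterated_deriv j).continuousOn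
  have hK : IsCompact (Set.Icc (1 : ℝ) 2 ×ℂ Set.Icc (-3 : ℝ) 3) :=
    isCompact_Icc.reProdIm isCompact_Icc
  obtain ⟨C, hC⟩ := hK.exists_bound_of_continuousOn
    (hcont.mono fun s hs => zetaMulSub_ne_zero (Complex.mem_reProdIm.1 hs).1.1)
  refine ⟨C, fun s h1 h2 h3 => ?_⟩
  have he : LSeries mangoldtSubOne =ᶠ[nhds s] g := by
    filter_upwards [eventually_one_lt_re h1] with z hz
      using LSeries_mangoldtSubOne_eq_zetaMulSub hz
  rw [he.iteratedDeriv_eq]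
  exact hC s (Complex.mem_reProdIm.2 ⟨⟨h1.le, h2⟩, abs_le.1 h3⟩)

lemma exists_norm_iteratedDeriv_mangoldtSubOne_le_of_le_im (j : ℕ) :
    ∃ C : ℝ, 0 < C ∧ ∀ s : ℂ, 1 < s.re → s.re ≤ 2 → 3 ≤ |s.im| →
      ‖iteratedDeriv j (LSeries mangoldtSubOne) s‖ ≤ C * |s.im| ^ (1 / 2 : ℝ) := by
  set θ : ℝ := 1 / (10 * (j + 1)) with hθdef
  have hθ : 0 < θ := by positivity
  have hθ' : θ ≤ 1 := by
    rw [hθdef, div_le_one (by positivity)]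
    linarith [j.cast_nonneg (α := ℝ)]
  obtain ⟨A, hA1, hA⟩ := exists_norm_riemannZeta_le hθ hθ'
  obtain ⟨B, hB1, hB⟩ := exists_norm_deriv_riemannZeta_le hθ hθ'
  obtain ⟨c, hc0, hcθ, hc⟩ := exists_le_norm_riemannZeta hθ hθ'
  refine ⟨j.factorial * (32 * (B / c + A)) * (32 / c) ^ j, by positivity, fun s h1 h2 h3 => ?_⟩
  set T := |s.im| ^ θ with hT
  have hT1 : 1 ≤ T := Real.one_le_rpow (by linarith) hθ.le
  set r := c / (32 * T ^ 5) with hr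
  have hr0 : 0 < r := by positivity
  have hrc : r ≤ c := div_le_self hc0.le (by nlinarith [one_le_pow₀ hT1 (n := 5)])
  have hball : ∀ w ∈ Metric.closedBall s r, w ≠ 1 ∧ riemannZeta w ≠ 0 ∧
      ‖-deriv riemannZeta w / riemannZeta w - riemannZeta w‖ ≤ 32 * (B / c + A) * T ^ 5 := by
    intro w hw
    obtain ⟨w1, w2, w3, w4⟩ := abs_im_sub_le_of_mem_closedBall hw
    have him : 2 ≤ |w.im| := by linarith
    set S := |w.im| ^ θ with hS
    have hS1 : 1 ≤ S := Real.one_le_rpow (by linarith) hθ.le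
    have hST : S ≤ 2 * T := rpow_le_two_mul_rpow (abs_nonneg _) (by linarith) hθ.le hθ'
    have hS5 : S ^ 5 ≤ 32 * T ^ 5 := by
      calc S ^ 5 ≤ (2 * T) ^ 5 := by gcongr
        _ = 32 * T ^ 5 := by ring
    have hrS : r ≤ c / S ^ 5 := by rw [hr]; gcongr
    have hlow := hc w (by linarith) (by linarith) him
    have hz0 : 0 < ‖riemannZeta w‖ := lt_of_lt_of_le (by positivity) hlow
    refine ⟨by rintro rfl; norm_num at him, norm_pos_iff.1 hz0, ?_⟩
    have e1 : ‖deriv riemannZeta w‖ / ‖riemannZeta w‖ ≤ (B * S) / (c / S ^ 4) := by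
      gcongr
      exact hB w (by linarith) (by linarith) him
    have e2 := hA w (by linarith) (by linarith) (by linarith)
    rw [← hS] at e2
    calc _ ≤ ‖deriv riemannZeta w‖ / ‖riemannZeta w‖ + ‖riemannZeta w‖ := by
          refine (norm_sub_le _ _).trans ?_
          rw [norm_div, norm_neg]
      _ ≤ (B * S) / (c / S ^ 4) + A * S := add_le_add e1 e2
      _ = B / c * S ^ 5 + A * S := by field_simp
      _ ≤ B / c * S ^ 5 + A * S ^ 5 := by
          gcongr
          exact le_self_pow₀ hS1 (by norm_num)
      _ = (B / c + A) * S ^ 5 := by ring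
      _ ≤ (B / c + A) * (32 * T ^ 5) := by gcongr
      _ = _ := by ring
  have hd : DiffContOnCl ℂ (fun w => -deriv riemannZeta w / riemannZeta w - riemannZeta w)
      (Metric.ball s r) := by
    refine DifferentiableOn.diffContOnCl fun w hw => ?_
    rw [closure_ball _ hr0.ne'] at hw
    obtain ⟨w1, w2, -⟩ := hball w hw
    have d1 := differentiableAt_riemannZeta w1
    have d2 : DifferentiableAt ℂ (deriv riemannZeta) w := by
      have : AnalyticAt ℂ riemannZeta w := by
        rw [Complex.analyticAt_iff_eventually_differentiableAt]
        filter_upwards [isOpen_ne.mem_nhds w1] with z hz using differentiableAt_riemannZeta hz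
      exact this.deriv.differentiableAt
    exact ((d2.neg.div d1 w2).sub d1).differentiableWithinAt
  have he : LSeries mangoldtSubOne =ᶠ[nhds s]
      fun w => -deriv riemannZeta w / riemannZeta w - riemannZeta w := by
    filter_upwards [eventually_one_lt_re h1] with z hz using LSeries_mangoldtSubOne hz
  rw [he.iteratedDeriv_eq]
  refine (Complex.norm_iteratedDeriv_le_of_forall_mem_sphere_norm_le j hr0 hd
    fun w hw => (hball w (Metric.sphere_subset_closedBall hw)).2.2).trans (le_of_eq ?_)
  have hpow : T ^ 5 * (T ^ 5) ^ j = |s.im| ^ (1 / 2 : ℝ) := by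
    rw [← pow_succ', ← pow_mul, hT, ← Real.rpow_mul_natCast (abs_nonneg _)]
    congr 1
    rw [hθdef]
    push_cast
    field_simp
    norm_num
  rw [← hpow, hr]
  field_simp
  rw [← mul_pow, ← mul_pow]
  field_simp
  simp

/-- The derivatives of `-ζ'/ζ - ζ` grow slowly, uniformly up to the line `Re s = 1`. -/
lemma exists_norm_iteratedDeriv_mangoldtSubOne_le (j : ℕ) :
    ∃ C : ℝ, 0 < C ∧ ∀ s : ℂ, 1 < s.re → s.re ≤ 2 →
      ‖iteratedDeriv j (LSeries mangoldtSubOne) s‖ ≤ C * (1 + |s.im|) ^ (1 / 2 : ℝ) := by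
  obtain ⟨A, hA⟩ := exists_norm_iteratedDeriv_mangoldtSubOne_le_of_im_le j
  obtain ⟨B, hB0, hB⟩ := exists_norm_iteratedDeriv_mangoldtSubOne_le_of_le_im j
  refine ⟨|A| + B, by positivity, fun s h1 h2 => ?_⟩
  have hT1 : 1 ≤ (1 + |s.im|) ^ (1 / 2 : ℝ) :=
    Real.one_le_rpow (by linarith [abs_nonneg s.im]) (by norm_num)
  rcases le_total |s.im| 3 with h | h
  · calc _ ≤ A := hA s h1 h2 h
      _ ≤ (|A| + B) * 1 := by linarith [le_abs_self A]
      _ ≤ _ := by gcongr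
  · refine (hB s h1 h2 h).trans ?_
    gcongr
    · linarith [abs_nonneg A]
    · linarith

section FourierInversion

open scoped FourierTransform

lemma logMul_iterate_apply (f : ℕ → ℂ) (j n : ℕ) :
    (LSeries.logMul^[j] f) n = Complex.log n ^ j * f n := by
  induction j with
  | zero => simp
  | succ j ih => rw [Function.iterate_succ_apply', LSeries.logMul, ih, pow_succ']; ring

lemma continuous_term_comp {f : ℕ → ℂ} {u : ℝ → ℂ} (hu : Continuous u) (n : ℕ) :
    Continuous fun ξ => LSeries.term f (u ξ) n := by
  rcases eq_or_ne n 0 with rfl | hn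
  · simp [continuous_const]
  · simp only [LSeries.term_of_ne_zero hn]
    have : (n : ℂ) ≠ 0 := by exact_mod_cast hn
    refine continuous_const.div (hu.const_cpow (Or.inl this)) fun ξ => ?_
    rw [Complex.cpow_ne_zero_iff]
    exact Or.inl this

/-- Fourier inversion applied to a Dirichlet series. -/
lemma hasSum_term_mul_fourierInv {a : ℕ → ℂ} {g : ℝ → ℂ} (hg : MeasureTheory.Integrable g)
    {σ : ℝ} (ha : LSeriesSummable a σ) :
    HasSum (fun n : ℕ => LSeries.term a σ n * 𝓕⁻ g (Real.log n))
      (∫ ξ : ℝ, LSeries a (σ - 2 * Real.pi * ξ * Complex.I) * g ξ) := by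
  have hu : Continuous fun ξ : ℝ => (σ - 2 * Real.pi * ξ * Complex.I : ℂ) := by fun_prop
  have hnorm : ∀ (n : ℕ) (ξ : ℝ), ‖LSeries.term a (σ - 2 * Real.pi * ξ * Complex.I) n‖ =
      ‖LSeries.term a σ n‖ := by
    intro n ξ
    simp [LSeries.norm_term_eq]
  have h := MeasureTheory.hasSum_integral_of_summable_integral_norm (μ := MeasureTheory.volume)
    (F := fun (n : ℕ) (ξ : ℝ) => LSeries.term a (σ - 2 * Real.pi * ξ * Complex.I) n * g ξ)
    (fun n => hg.bdd_mul (c := ‖LSeries.term a σ n‖)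
      (continuous_term_comp hu n).aestronglyMeasurable
      (Eventually.of_forall fun ξ => (hnorm n ξ).le)) (by
      simp only [norm_mul, hnorm, MeasureTheory.integral_const_mul]
      exact ha.norm.mul_right _)
  simp only [tsum_mul_right] at h
  refine h.congr_fun fun n => ?_
  rw [Real.fourierInv_eq', ← MeasureTheory.integral_const_mul]
  refine MeasureTheory.integral_congr_ae (Eventually.of_forall fun ξ => ?_)
  simp only [smul_eq_mul, ← mul_assoc]
  congr 1
  rcases eq_or_ne n 0 with rfl | hn
  · simp
  have hn' : (n : ℂ) ≠ 0 := by exact_mod_cast hn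
  rw [LSeries.term_of_ne_zero hn, LSeries.term_of_ne_zero hn, Complex.cpow_sub _ _ hn']
  have : (n : ℂ) ^ (2 * Real.pi * ξ * Complex.I : ℂ) =
      Complex.exp (2 * Real.pi * (Real.log n * ξ) * Complex.I) := by
    rw [Complex.cpow_def_of_ne_zero hn', ← Complex.natCast_log]
    congr 1
    ring
  rw [this, div_div_eq_mul_div]
  simp
  ring_nf

lemma integrable_of_continuous_of_eq_zero {f : ℝ → ℂ} (hf : Continuous f) {α β : ℝ}
    (h0 : ∀ x, x ∉ Set.Icc α β → f x = 0) : MeasureTheory.Integrable f :=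
  hf.integrable_of_hasCompactSupport (HasCompactSupport.intro isCompact_Icc h0)

lemma norm_fourier_le_of_eq_zero {f : ℝ → ℂ} {α β B : ℝ} (hαβ : α ≤ β)
    (h0 : ∀ x, x ∉ Set.Icc α β → f x = 0) (hB : ∀ x, ‖f x‖ ≤ B) (ξ : ℝ) :
    ‖𝓕 f ξ‖ ≤ (β - α) * B := by
  rw [Real.fourier_eq, ← MeasureTheory.setIntegral_eq_integral_of_forall_compl_eq_zero
    (s := Set.Icc α β) fun x hx => by simp [h0 x hx]]
  have := MeasureTheory.norm_setIntegral_le_of_norm_le_const (μ := MeasureTheory.volume)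
    (s := Set.Icc α β) (f := fun v => 𝐞 (-inner ℝ v ξ) • f v) (C := B) (by simp)
    (fun x _ => by rw [Circle.norm_smul]; exact hB x)
  refine this.trans (le_of_eq ?_)
  rw [Real.volume_real_Icc_of_le hαβ]
  ring

/-- A compactly supported test function together with its first two derivatives. -/
structure IsTestTriple (f f' f'' : ℝ → ℂ) (α β B : ℝ) : Prop where
  le : α ≤ β
  hasDerivAt : ∀ x, HasDerivAt f (f' x) x
  hasDerivAt' : ∀ x, HasDerivAt f' (f'' x) x
  cont : Continuous f''
  eq_zero : ∀ x, x ∉ Set.Icc α β → f x = 0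
  eq_zero' : ∀ x, x ∉ Set.Icc α β → f' x = 0
  eq_zero'' : ∀ x, x ∉ Set.Icc α β → f'' x = 0
  bound : ∀ x, ‖f x‖ ≤ B
  bound'' : ∀ x, ‖f'' x‖ ≤ B

lemma IsTestTriple.continuous {f f' f'' : ℝ → ℂ} {α β B : ℝ} (h : IsTestTriple f f' f'' α β B) :
    Continuous f :=
  continuous_iff_continuousAt.2 fun x => (h.hasDerivAt x).continuousAt

lemma IsTestTriple.norm_fourier_le {f f' f'' : ℝ → ℂ} {α β B : ℝ}
    (h : IsTestTriple f f' f'' α β B) (ξ : ℝ) :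
    ‖𝓕 f ξ‖ ≤ 4 * ((β - α) * B) * (1 + |2 * Real.pi * ξ|) ^ (-(2 : ℝ)) := by
  have hc' : Continuous f' := continuous_iff_continuousAt.2 fun x => (h.hasDerivAt' x).continuousAt
  have hi := integrable_of_continuous_of_eq_zero h.continuous h.eq_zero
  have hi' := integrable_of_continuous_of_eq_zero hc' h.eq_zero'
  have hi'' := integrable_of_continuous_of_eq_zero h.cont h.eq_zero''
  have e1 : deriv f = f' := funext fun x => (h.hasDerivAt x).deriv
  have e2 : deriv f' = f'' := funext fun x => (h.hasDerivAt' x).deriv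
  have f1 := Real.fourier_deriv hi (fun x => (h.hasDerivAt x).differentiableAt) (by rwa [e1])
  have f2 := Real.fourier_deriv hi' (fun x => (h.hasDerivAt' x).differentiableAt) (by rwa [e2])
  rw [e1] at f1
  rw [e2, f1] at f2
  have b0 := norm_fourier_le_of_eq_zero h.le h.eq_zero h.bound ξ
  have b2 := norm_fourier_le_of_eq_zero h.le h.eq_zero'' h.bound'' ξ
  rw [f2] at b2
  simp only [norm_smul] at b2
  set y := |2 * Real.pi * ξ| with hy
  have hny : ‖(2 * Real.pi * Complex.I * ξ : ℂ)‖ = y := by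
    rw [hy, abs_mul, abs_mul]
    simp
  rw [hny] at b2
  have hy0 : 0 ≤ y := abs_nonneg _
  rw [Real.rpow_neg (by positivity), ← div_eq_mul_inv, le_div_iff₀ (by positivity),
    show (2 : ℝ) = ((2 : ℕ) : ℝ) by norm_num, Real.rpow_natCast]
  nlinarith [mul_nonneg (sq_nonneg (1 - y)) (norm_nonneg (𝓕 f ξ))]

lemma exists_norm_sum_mangoldtSubOne_le (j : ℕ) :
    ∃ C : ℝ, 0 < C ∧ ∀ (f f' f'' : ℝ → ℂ) (α β B : ℝ), IsTestTriple f f' f'' α β B →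
      ∀ M : ℕ, (∀ n : ℕ, M ≤ n → f (Real.log n) = 0) →
      ‖∑ n ∈ Finset.range M, mangoldtSubOne n * (Real.log n : ℂ) ^ j / n * f (Real.log n)‖ ≤
        C * ((β - α) * B) := by
  obtain ⟨C, hC0, hC⟩ := exists_norm_iteratedDeriv_mangoldtSubOne_le j
  have hJ : MeasureTheory.Integrable
      (fun ξ : ℝ => (1 + |2 * Real.pi * ξ|) ^ (-(3 / 2 : ℝ))) := by
    have h := integrable_one_add_norm (E := ℝ) (μ := MeasureTheory.volume) (r := 3 / 2)
      (by simp; norm_num)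
    exact h.comp_mul_left' (R := 2 * Real.pi) (by positivity)
  have hJ2 : MeasureTheory.Integrable
      (fun ξ : ℝ => (1 + |2 * Real.pi * ξ|) ^ (-(2 : ℝ))) := by
    have h := integrable_one_add_norm (E := ℝ) (μ := MeasureTheory.volume) (r := 2)
      (by simp)
    exact h.comp_mul_left' (R := 2 * Real.pi) (by positivity)
  set J := ∫ ξ : ℝ, (1 + |2 * Real.pi * ξ|) ^ (-(3 / 2 : ℝ)) with hJdef
  have hJ0 : 0 ≤ J := MeasureTheory.integral_nonneg fun ξ => by positivity
  refine ⟨C * 4 * (J + 1), by positivity, fun f f' f'' α β B h M hM => ?_⟩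
  have hB0 : 0 ≤ B := (norm_nonneg _).trans (h.bound 0)
  have hK0 : 0 ≤ (β - α) * B := mul_nonneg (sub_nonneg.2 h.le) hB0
  have hFc : Continuous (𝓕 f) := by
    have := VectorFourier.fourierIntegral_continuous (L := innerₗ ℝ) (μ := MeasureTheory.volume)
      Real.continuous_fourierChar (by fun_prop)
      (integrable_of_continuous_of_eq_zero h.continuous h.eq_zero)
    exact this
  have hFi : MeasureTheory.Integrable (𝓕 f) :=
    (hJ2.const_mul _).mono' hFc.aestronglyMeasurable (Eventually.of_forall h.norm_fourier_le)
  have hinv : 𝓕⁻ (𝓕 f) = f := h.continuous.fourierInv_fourier_eq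
    (integrable_of_continuous_of_eq_zero h.continuous h.eq_zero) hFi
  set a := LSeries.logMul^[j] mangoldtSubOne with ha
  have hσ : ∀ σ : ℝ, 1 < σ → σ ≤ 2 →
      ‖∑ n ∈ Finset.range M, LSeries.term a σ n * f (Real.log n)‖ ≤
        C * 4 * (J + 1) * ((β - α) * B) := by
    intro σ h1 h2
    have hsum : LSeriesSummable a σ := by
      refine LSeriesSummable_of_abscissaOfAbsConv_lt_re ?_
      rw [ha, LSeries.absicssaOfAbsConv_logPowMul]
      exact abscissaOfAbsConv_mangoldtSubOne_lt (by simpa using h1)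
    have hs := hasSum_term_mul_fourierInv hFi hsum
    rw [hinv] at hs
    have hfin : HasSum (fun n : ℕ => LSeries.term a σ n * f (Real.log n))
        (∑ n ∈ Finset.range M, LSeries.term a σ n * f (Real.log n)) :=
      hasSum_sum_of_ne_finset_zero fun n hn => by rw [hM n (by simpa using hn), mul_zero]
    rw [hfin.unique hs]
    refine (MeasureTheory.norm_integral_le_of_norm_le
      (g := fun ξ => C * 4 * ((β - α) * B) * (1 + |2 * Real.pi * ξ|) ^ (-(3 / 2 : ℝ)))
      (hJ.const_mul _) (Eventually.of_forall fun ξ => ?_)).trans ?_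
    · have hre : 1 < (σ - 2 * Real.pi * ξ * Complex.I : ℂ).re := by simpa using h1
      have hL := hC (σ - 2 * Real.pi * ξ * Complex.I) hre (by simpa using h2)
      rw [LSeries_iteratedDeriv j (abscissaOfAbsConv_mangoldtSubOne_lt hre), norm_mul, norm_pow,
        norm_neg, norm_one, one_pow, one_mul] at hL
      have him : |(σ - 2 * Real.pi * ξ * Complex.I : ℂ).im| = |2 * Real.pi * ξ| := by simp
      rw [him] at hL
      rw [norm_mul]
      calc _ ≤ C * (1 + |2 * Real.pi * ξ|) ^ (1 / 2 : ℝ) *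
            (4 * ((β - α) * B) * (1 + |2 * Real.pi * ξ|) ^ (-(2 : ℝ))) :=
            mul_le_mul hL (h.norm_fourier_le ξ) (norm_nonneg _) (by positivity)
        _ = C * 4 * ((β - α) * B) * ((1 + |2 * Real.pi * ξ|) ^ (1 / 2 : ℝ) *
            (1 + |2 * Real.pi * ξ|) ^ (-(2 : ℝ))) := by ring
        _ = _ := by
            rw [← Real.rpow_add (by positivity)]
            norm_num
    · rw [MeasureTheory.integral_const_mul, ← hJdef]
      have : 0 ≤ C * 4 * ((β - α) * B) := by positivity
      nlinarith
  have hcont : Continuous fun σ : ℝ =>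
      ‖∑ n ∈ Finset.range M, LSeries.term a σ n * f (Real.log n)‖ :=
    (continuous_finsetSum _ fun n _ =>
      (continuous_term_comp Complex.continuous_ofReal n).mul continuous_const).norm
  have hlim := (hcont.tendsto 1).mono_left (nhdsWithin_le_nhds (s := Set.Ioi 1))
  have hev : ∀ᶠ σ : ℝ in nhdsWithin 1 (Set.Ioi 1),
      ‖∑ n ∈ Finset.range M, LSeries.term a σ n * f (Real.log n)‖ ≤
        C * 4 * (J + 1) * ((β - α) * B) := by
    filter_upwards [Ioc_mem_nhdsGT (show (1 : ℝ) < 2 by norm_num)] with σ hσ'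
      using hσ σ hσ'.1 hσ'.2
  have := le_of_tendsto hlim hev
  refine le_trans (le_of_eq ?_) this
  congr 1
  refine Finset.sum_congr rfl fun n _ => ?_
  congr 1
  rcases eq_or_ne n 0 with rfl | hn
  · simp
  · rw [LSeries.term_of_ne_zero hn, ha, logMul_iterate_apply, ← Complex.natCast_log]
    simp
    ring

end FourierInversion

lemma exists_hasDerivAt_smoothTransition :
    ∃ (p' p'' : ℝ → ℝ) (D : ℝ), 1 ≤ D ∧ (∀ x, HasDerivAt Real.smoothTransition (p' x) x) ∧
      (∀ x, HasDerivAt p' (p'' x) x) ∧ Continuous p'' ∧ (∀ x ≤ 0, p' x = 0) ∧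
      (∀ x ≤ 0, p'' x = 0) ∧ (∀ x, |p' x| ≤ D) ∧ ∀ x, |p'' x| ≤ D := by
  have hs : ContDiff ℝ 2 Real.smoothTransition := Real.smoothTransition.contDiff
  have hs' : ContDiff ℝ 1 (deriv Real.smoothTransition) := by
    have : ContDiff ℝ (1 + 1) Real.smoothTransition := hs
    exact (contDiff_succ_iff_deriv.1 this).2.2
  have hd : ∀ x, HasDerivAt Real.smoothTransition (deriv Real.smoothTransition x) x :=
    fun x => (hs.differentiable (by norm_num) x).hasDerivAt
  have hd' : ∀ x, HasDerivAt (deriv Real.smoothTransition)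
      (deriv (deriv Real.smoothTransition) x) x :=
    fun x => (hs'.differentiable (by norm_num) x).hasDerivAt
  have hc'' : Continuous (deriv (deriv Real.smoothTransition)) :=
    hs'.continuous_deriv le_rfl
  have z1 : ∀ x < 0, deriv Real.smoothTransition x = 0 := fun x hx => by
    have : Real.smoothTransition =ᶠ[nhds x] fun _ => 0 := by
      filter_upwards [Iio_mem_nhds hx] with y hy
      exact Real.smoothTransition.zero_of_nonpos (le_of_lt hy)
    rw [this.deriv_eq, deriv_const]
  have z2 : ∀ x < 0, deriv (deriv Real.smoothTransition) x = 0 := fun x hx => by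
    have : deriv Real.smoothTransition =ᶠ[nhds x] fun _ => 0 := by
      filter_upwards [Iio_mem_nhds hx] with y hy using z1 y hy
    rw [this.deriv_eq, deriv_const]
  have o1 : ∀ x > 1, deriv Real.smoothTransition x = 0 := fun x hx => by
    have : Real.smoothTransition =ᶠ[nhds x] fun _ => 1 := by
      filter_upwards [Ioi_mem_nhds hx] with y hy
      exact Real.smoothTransition.one_of_one_le (le_of_lt hy)
    rw [this.deriv_eq, deriv_const]
  have o2 : ∀ x > 1, deriv (deriv Real.smoothTransition) x = 0 := fun x hx => by
    have : deriv Real.smoothTransition =ᶠ[nhds x] fun _ => 0 := by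
      filter_upwards [Ioi_mem_nhds hx] with y hy using o1 y hy
    rw [this.deriv_eq, deriv_const]
  have ext0 : ∀ g : ℝ → ℝ, Continuous g → (∀ x < 0, g x = 0) → ∀ x ≤ 0, g x = 0 := by
    intro g hg h x hx
    rcases hx.lt_or_eq with hx | rfl
    · exact h x hx
    · have h1 := (hg.tendsto 0).mono_left (nhdsWithin_le_nhds (s := Set.Iio (0 : ℝ)))
      have h2 : Tendsto g (nhdsWithin 0 (Set.Iio 0)) (nhds 0) :=
        tendsto_const_nhds.congr' (by
          filter_upwards [self_mem_nhdsWithin] with y hy using (h y hy).symm)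
      exact tendsto_nhds_unique h1 h2
  have bdd : ∀ g : ℝ → ℝ, Continuous g → (∀ x < 0, g x = 0) → (∀ x > 1, g x = 0) →
      ∃ D, ∀ x, |g x| ≤ D := by
    intro g hg h0 h1
    have hsupp : HasCompactSupport g := HasCompactSupport.intro (isCompact_Icc (a := 0) (b := 1))
      fun x hx => by
        by_cases h : x < 0
        · exact h0 x h
        · exact h1 x (by by_contra h2; exact hx ⟨not_lt.1 h, not_lt.1 h2⟩)
    exact hsupp.exists_bound_of_continuous hg
  obtain ⟨D₁, h₁⟩ := bdd _ hs'.continuous z1 o1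
  obtain ⟨D₂, h₂⟩ := bdd _ hc'' z2 o2
  exact ⟨_, _, max 1 (max D₁ D₂), le_max_left _ _, hd, hd', hc'', ext0 _ hs'.continuous z1,
    ext0 _ hc'' z2, fun x => (h₁ x).trans ((le_max_left _ _).trans (le_max_right _ _)),
    fun x => (h₂ x).trans ((le_max_right _ _).trans (le_max_right _ _))⟩

/-- A smooth cutoff supported in `[α, β]` and equal to `1` on `[α + δ, β - δ]`. -/
noncomputable def smoothCutoff (α β δ v : ℝ) : ℝ :=
  Real.smoothTransition ((v - α) / δ) * Real.smoothTransition ((β - v) / δ)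

lemma smoothCutoff_nonneg (α β δ v : ℝ) : 0 ≤ smoothCutoff α β δ v :=
  mul_nonneg (Real.smoothTransition.nonneg _) (Real.smoothTransition.nonneg _)

lemma smoothCutoff_le_one (α β δ v : ℝ) : smoothCutoff α β δ v ≤ 1 :=
  mul_le_one₀ (Real.smoothTransition.le_one _) (Real.smoothTransition.nonneg _)
    (Real.smoothTransition.le_one _)

lemma smoothCutoff_eq_zero_of_le {α δ v : ℝ} (β : ℝ) (hδ : 0 < δ) (h : v ≤ α) :
    smoothCutoff α β δ v = 0 := by
  rw [smoothCutoff, Real.smoothTransition.zero_of_nonpos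
    (div_nonpos_of_nonpos_of_nonneg (by linarith) hδ.le), zero_mul]

lemma smoothCutoff_eq_zero_of_ge {β δ v : ℝ} (α : ℝ) (hδ : 0 < δ) (h : β ≤ v) :
    smoothCutoff α β δ v = 0 := by
  rw [smoothCutoff, Real.smoothTransition.zero_of_nonpos (x := (β - v) / δ)
    (div_nonpos_of_nonpos_of_nonneg (by linarith) hδ.le), mul_zero]

lemma smoothCutoff_eq_one {α β δ v : ℝ} (hδ : 0 < δ) (h : α + δ ≤ v) (h' : v ≤ β - δ) :
    smoothCutoff α β δ v = 1 := by
  rw [smoothCutoff, Real.smoothTransition.one_of_one_le ((one_le_div hδ).2 (by linarith)),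
    Real.smoothTransition.one_of_one_le ((one_le_div hδ).2 (by linarith)), one_mul]

/-- The product of a smooth cutoff and a negative power is an admissible test function. -/
lemma exists_isTestTriple_smoothCutoff (k : ℕ) :
    ∃ K : ℝ, 0 < K ∧ ∀ α β δ : ℝ, 1 ≤ α → α ≤ β → 0 < δ → δ ≤ 1 → ∃ f' f'' : ℝ → ℂ,
      IsTestTriple (fun v => ((v ^ k)⁻¹ * smoothCutoff α β δ v : ℝ)) f' f'' α β
        (K * ((α ^ k)⁻¹ * (δ ^ 2)⁻¹)) := by
  obtain ⟨p', p'', D, hD, hd, hd', hc, z1, z2, b1, b2⟩ := exists_hasDerivAt_smoothTransition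
  set p := Real.smoothTransition with hp
  refine ⟨k * (k + 1) + 4 * k * D + 4 * D ^ 2, by positivity, fun α β δ hα hαβ hδ hδ1 => ?_⟩
  let w : ℝ → ℝ := fun v => (v ^ k)⁻¹
  let w' : ℝ → ℝ := fun v => -k * (v ^ (k + 1))⁻¹
  let w'' : ℝ → ℝ := fun v => k * (k + 1) * (v ^ (k + 2))⁻¹
  let χ : ℝ → ℝ := smoothCutoff α β δ
  let χ' : ℝ → ℝ := fun v =>
    p' ((v - α) / δ) * δ⁻¹ * p ((β - v) / δ) - p ((v - α) / δ) * (p' ((β - v) / δ) * δ⁻¹)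
  let χ'' : ℝ → ℝ := fun v =>
    p'' ((v - α) / δ) * δ⁻¹ ^ 2 * p ((β - v) / δ)
      - 2 * (p' ((v - α) / δ) * δ⁻¹ * (p' ((β - v) / δ) * δ⁻¹))
      + p ((v - α) / δ) * (p'' ((β - v) / δ) * δ⁻¹ ^ 2)
  have hl : ∀ v, HasDerivAt (fun v : ℝ => (v - α) / δ) δ⁻¹ v := fun v => by
    simpa using ((hasDerivAt_id v).sub_const α).div_const δ
  have hr : ∀ v, HasDerivAt (fun v : ℝ => (β - v) / δ) (-δ⁻¹) v := fun v => by
    simpa [neg_div] using ((hasDerivAt_id v).const_sub β).div_const δ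
  have hχ : ∀ v, HasDerivAt χ (χ' v) v := fun v => by
    refine (((hd _).comp v (hl v)).mul ((hd _).comp v (hr v))).congr_deriv ?_
    simp only [Function.comp_def, χ']
    ring
  have hχ' : ∀ v, HasDerivAt χ' (χ'' v) v := fun v => by
    refine (((((hd' _).comp v (hl v)).mul_const δ⁻¹).mul ((hd _).comp v (hr v))).sub
      (((hd _).comp v (hl v)).mul (((hd' _).comp v (hr v)).mul_const δ⁻¹))).congr_deriv ?_
    simp only [Function.comp_def, χ'']
    ring
  have hχc : Continuous χ'' := by
    have c0 : Continuous p := Real.smoothTransition.continuous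
    have c1 : Continuous p' := continuous_iff_continuousAt.2 fun x => (hd' x).continuousAt
    fun_prop
  have hpow : ∀ (m : ℕ) (v : ℝ), 0 < v →
      HasDerivAt (fun v : ℝ => (v ^ m)⁻¹) (-m * (v ^ (m + 1))⁻¹) v := fun m v hv => by
    refine ((hasDerivAt_pow m v).inv (by positivity)).congr_deriv ?_
    rcases m with _ | m
    · simp
    · simp only [Nat.add_sub_cancel]
      field_simp
      ring
  have hw : ∀ v, 0 < v → HasDerivAt w (w' v) v := fun v hv => hpow k v hv
  have hw' : ∀ v, 0 < v → HasDerivAt w' (w'' v) v := fun v hv => by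
    refine ((hpow (k + 1) v hv).const_mul (-k : ℝ)).congr_deriv ?_
    simp only [w'']
    push_cast
    ring
  have out : ∀ v, v ∉ Set.Icc α β → χ v = 0 ∧ χ' v = 0 ∧ χ'' v = 0 := by
    intro v hv
    by_cases h : v < α
    · have h1 : (v - α) / δ ≤ 0 := div_nonpos_of_nonpos_of_nonneg (by linarith) hδ.le
      refine ⟨smoothCutoff_eq_zero_of_le β hδ h.le, ?_, ?_⟩
      · simp only [χ', z1 _ h1, hp, Real.smoothTransition.zero_of_nonpos h1]; ring
      · simp only [χ'', z1 _ h1, z2 _ h1, hp, Real.smoothTransition.zero_of_nonpos h1]; ring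
    · have hv' : β < v := by
        by_contra h2
        exact hv ⟨not_lt.1 h, not_lt.1 h2⟩
      have h1 : (β - v) / δ ≤ 0 := div_nonpos_of_nonpos_of_nonneg (by linarith) hδ.le
      refine ⟨smoothCutoff_eq_zero_of_ge α hδ hv'.le, ?_, ?_⟩
      · simp only [χ', z1 _ h1, hp, Real.smoothTransition.zero_of_nonpos h1]; ring
      · simp only [χ'', z1 _ h1, z2 _ h1, hp, Real.smoothTransition.zero_of_nonpos h1]; ring
  let f : ℝ → ℝ := fun v => w v * χ v
  let f' : ℝ → ℝ := fun v => w' v * χ v + w v * χ' v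
  let f'' : ℝ → ℝ := fun v => w'' v * χ v + 2 * (w' v * χ' v) + w v * χ'' v
  have near : ∀ v, v ≤ 0 → ∀ᶠ y in nhds v, χ y = 0 ∧ χ' y = 0 ∧ χ'' y = 0 := fun v hv => by
    filter_upwards [Iio_mem_nhds (show v < α by linarith)] with y hy
      using out y fun h => absurd h.1 (not_le.2 hy)
  have hf : ∀ v, HasDerivAt f (f' v) v := fun v => by
    rcases lt_or_ge 0 v with hv | hv
    · exact (hw v hv).mul (hχ v)
    · have h0 := (near v hv).self_of_nhds
      have : f' v = 0 := by simp [f', h0.1, h0.2.1]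
      rw [this]
      refine (hasDerivAt_const v (0 : ℝ)).congr_of_eventuallyEq ?_
      filter_upwards [near v hv] with y hy
      simp [f, hy.1]
  have hf' : ∀ v, HasDerivAt f' (f'' v) v := fun v => by
    rcases lt_or_ge 0 v with hv | hv
    · refine (((hw' v hv).mul (hχ v)).add ((hw v hv).mul (hχ' v))).congr_deriv ?_
      simp only [f'']
      ring
    · have h0 := (near v hv).self_of_nhds
      have : f'' v = 0 := by simp [f'', h0.1, h0.2.1, h0.2.2]
      rw [this]
      refine (hasDerivAt_const v (0 : ℝ)).congr_of_eventuallyEq ?_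
      filter_upwards [near v hv] with y hy
      simp [f', hy.1, hy.2.1]
  have hfc : Continuous f'' := continuous_iff_continuousAt.2 fun v => by
    rcases lt_or_ge 0 v with hv | hv
    · have h1 : ContinuousAt w'' v := by
        have : ContinuousAt (fun v : ℝ => (v ^ (k + 2))⁻¹) v :=
          (hpow (k + 2) v hv).continuousAt
        exact this.const_mul _
      exact ((h1.mul (hχ v).continuousAt).add (((hw' v hv).continuousAt.mul
        (hχ' v).continuousAt).const_mul 2)).add ((hw v hv).continuousAt.mul hχc.continuousAt)
    · refine (continuousAt_const (y := (0 : ℝ))).congr ?_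
      filter_upwards [near v hv] with y hy
      simp [f'', hy.1, hy.2.1, hy.2.2]
  set A := (α ^ k)⁻¹ with hA
  have hA0 : 0 < A := by positivity
  set E := δ⁻¹ with hE
  have hE1 : 1 ≤ E := (one_le_inv₀ hδ).2 hδ1
  have hE2 : (δ ^ 2)⁻¹ = E ^ 2 := by rw [hE, inv_pow]
  have pabs : ∀ x, |p x| ≤ 1 := fun x => by
    rw [abs_of_nonneg (Real.smoothTransition.nonneg x)]
    exact Real.smoothTransition.le_one x
  have wb : ∀ (m : ℕ) (v : ℝ), α ≤ v → |(v ^ (k + m))⁻¹| ≤ A := fun m v hv => by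
    have hv0 : 0 < v := by linarith
    rw [abs_of_pos (by positivity)]
    refine inv_anti₀ (by positivity) ?_
    calc α ^ k ≤ v ^ k := by gcongr
      _ ≤ v ^ (k + m) := pow_le_pow_right₀ (by linarith) (by omega)
  have χb : ∀ v, |χ v| ≤ 1 := fun v => by
    rw [abs_of_nonneg (smoothCutoff_nonneg _ _ _ _)]
    exact smoothCutoff_le_one _ _ _ _
  have χb' : ∀ v, |χ' v| ≤ 2 * (D * E) := fun v => by
    refine (abs_sub _ _).trans ?_
    rw [abs_mul, abs_mul, abs_mul, abs_mul, abs_of_pos (show 0 < E by linarith)]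
    have h1 : |p' ((v - α) / δ)| * E * |p ((β - v) / δ)| ≤ D * E * 1 := by
      gcongr
      · exact b1 _
      · exact pabs _
    have h2 : |p ((v - α) / δ)| * (|p' ((β - v) / δ)| * E) ≤ 1 * (D * E) := by
      gcongr
      · exact pabs _
      · exact b1 _
    linarith
  have χb'' : ∀ v, |χ'' v| ≤ 4 * (D ^ 2 * E ^ 2) := fun v => by
    have hE0 : 0 < E := by linarith
    refine (abs_add_le _ _).trans ?_
    have h1 : |p'' ((v - α) / δ) * E ^ 2 * p ((β - v) / δ)| ≤ D * E ^ 2 * 1 := by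
      rw [abs_mul, abs_mul, abs_of_pos (pow_pos hE0 2)]
      gcongr
      · exact b2 _
      · exact pabs _
    have h2 : |2 * (p' ((v - α) / δ) * E * (p' ((β - v) / δ) * E))| ≤ 2 * (D * E * (D * E)) := by
      rw [abs_mul, abs_mul, abs_mul, abs_mul, abs_of_pos hE0, abs_two]
      gcongr
      · exact b1 _
      · exact b1 _
    have h3 : |p ((v - α) / δ) * (p'' ((β - v) / δ) * E ^ 2)| ≤ 1 * (D * E ^ 2) := by
      rw [abs_mul, abs_mul, abs_of_pos (pow_pos hE0 2)]
      gcongr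
      · exact pabs _
      · exact b2 _
    have h4 := abs_sub (p'' ((v - α) / δ) * E ^ 2 * p ((β - v) / δ))
      (2 * (p' ((v - α) / δ) * E * (p' ((β - v) / δ) * E)))
    have h5 : D * E ^ 2 ≤ D ^ 2 * E ^ 2 := by
      gcongr
      nlinarith
    nlinarith
  have hk0 : (0 : ℝ) ≤ k := k.cast_nonneg
  have hEE : E ≤ E ^ 2 := by nlinarith
  refine ⟨fun v => f' v, fun v => f'' v, hαβ, fun v => (hf v).ofReal_comp,
    fun v => (hf' v).ofReal_comp, Complex.continuous_ofReal.comp hfc, fun v hv => ?_,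
    fun v hv => ?_, fun v hv => ?_, fun v => ?_, fun v => ?_⟩
  · have : smoothCutoff α β δ v = 0 := (out v hv).1
    simp [this]
  · simp [f', (out v hv).1, (out v hv).2.1]
  · simp [f'', (out v hv).1, (out v hv).2.1, (out v hv).2.2]
  · rw [Complex.norm_real, Real.norm_eq_abs, hE2]
    by_cases hv : v ∈ Set.Icc α β
    · rw [abs_mul]
      calc |(v ^ k)⁻¹| * |smoothCutoff α β δ v| ≤ A * 1 := by
            gcongr
            · exact wb 0 v hv.1
            · exact χb v
        _ ≤ 4 * D ^ 2 * (A * E ^ 2) := by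
            have h1 : 1 ≤ E ^ 2 := one_le_pow₀ hE1
            have h2 : 1 ≤ D ^ 2 := one_le_pow₀ hD
            nlinarith [mul_le_mul h1 h2 zero_le_one (by positivity)]
        _ ≤ _ := by
            have : 0 ≤ (k * (k + 1) + 4 * k * D) * (A * E ^ 2) := by positivity
            linarith
    · have : smoothCutoff α β δ v = 0 := (out v hv).1
      rw [this, mul_zero, abs_zero]
      positivity
  · rw [Complex.norm_real, Real.norm_eq_abs, hE2]
    by_cases hv : v ∈ Set.Icc α β
    · have t1 : |w'' v * χ v| ≤ k * (k + 1) * A * 1 := by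
        rw [abs_mul, abs_mul, abs_of_nonneg (show (0 : ℝ) ≤ k * (k + 1) by positivity)]
        gcongr
        · exact wb 2 v hv.1
        · exact χb v
      have t2 : |2 * (w' v * χ' v)| ≤ 2 * (k * A * (2 * (D * E))) := by
        rw [abs_mul, abs_mul, abs_mul, abs_neg, abs_two, abs_of_nonneg hk0]
        gcongr
        · exact wb 1 v hv.1
        · exact χb' v
      have t3 : |w v * χ'' v| ≤ A * (4 * (D ^ 2 * E ^ 2)) := by
        rw [abs_mul]
        gcongr
        · exact wb 0 v hv.1
        · exact χb'' v
      have h1 : 1 ≤ E ^ 2 := one_le_pow₀ hE1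
      have h2 : k * (k + 1) * A * 1 ≤ k * (k + 1) * A * E ^ 2 := by gcongr
      have h3 : 2 * (k * A * (2 * (D * E))) ≤ 2 * (k * A * (2 * (D * E ^ 2))) := by gcongr
      have h4 := abs_add_le (w'' v * χ v + 2 * (w' v * χ' v)) (w v * χ'' v)
      have h5 := abs_add_le (w'' v * χ v) (2 * (w' v * χ' v))
      change |w'' v * χ v + 2 * (w' v * χ' v) + w v * χ'' v| ≤ _
      nlinarith
    · simp only [f'', (out v hv).1, (out v hv).2.1, (out v hv).2.2, mul_zero, add_zero, abs_zero]
      positivity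

lemma exists_abs_sum_vonMangoldt_sub_one_mul_smoothCutoff_le (k : ℕ) :
    ∃ C : ℝ, 0 < C ∧ ∀ α β δ : ℝ, 1 ≤ α → α ≤ β → 0 < δ → δ ≤ 1 →
      ∀ M : ℕ, (∀ n : ℕ, M ≤ n → β ≤ Real.log n) →
      |∑ n ∈ Finset.range M, (ArithmeticFunction.vonMangoldt n - 1) / (n * Real.log n) *
        smoothCutoff α β δ (Real.log n)| ≤ C * ((β - α) * ((α ^ (k + 1))⁻¹ * (δ ^ 2)⁻¹)) := by
  obtain ⟨C, hC, h⟩ := exists_norm_sum_mangoldtSubOne_le k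
  obtain ⟨K, hK, hK'⟩ := exists_isTestTriple_smoothCutoff (k + 1)
  refine ⟨C * K, by positivity, fun α β δ hα hαβ hδ hδ1 M hM => ?_⟩
  obtain ⟨f', f'', ht⟩ := hK' α β δ hα hαβ hδ hδ1
  have := h _ _ _ _ _ _ ht M fun n hn => by
    rw [smoothCutoff_eq_zero_of_ge α hδ (hM n hn), mul_zero, Complex.ofReal_zero]
  refine le_trans (le_of_eq ?_) (this.trans (le_of_eq (by ring)))
  rw [← Real.norm_eq_abs, ← Complex.norm_real]
  congr 1
  push_cast
  refine Finset.sum_congr rfl fun n _ => ?_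
  rcases le_or_gt (Real.log n) α with hn | hn
  · simp [smoothCutoff_eq_zero_of_le β hδ hn]
  · have hl : Complex.log n ≠ 0 := by
      rw [← Complex.natCast_log]
      exact_mod_cast (show (0 : ℝ) < Real.log n by linarith).ne'
    rw [mangoldtSubOne, pow_succ]
    field_simp

lemma log_log_succ_sub_bounds {n : ℕ} (hn : 2 ≤ n) :
    1 / ((n + 1 : ℕ) * Real.log (n + 1 : ℕ)) ≤
        Real.log (Real.log (n + 1 : ℕ)) - Real.log (Real.log n) ∧
      Real.log (Real.log (n + 1 : ℕ)) - Real.log (Real.log n) ≤ 1 / (n * Real.log n) := by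
  have hn2 : (2 : ℝ) ≤ n := by exact_mod_cast hn
  have hn0 : (0 : ℝ) < n := by linarith
  have hn1 : (0 : ℝ) < ((n + 1 : ℕ) : ℝ) := by positivity
  have hl : 0 < Real.log n := Real.log_pos (by linarith)
  have hl' : 0 < Real.log (n + 1 : ℕ) := Real.log_pos (by push_cast; linarith)
  have hup : Real.log (n + 1 : ℕ) - Real.log n ≤ 1 / n := by
    rw [← Real.log_div hn1.ne' hn0.ne']
    refine (Real.log_le_sub_one_of_pos (by positivity)).trans (le_of_eq ?_)
    push_cast
    field_simp
    ring
  have hlow : 1 / ((n + 1 : ℕ) : ℝ) ≤ Real.log (n + 1 : ℕ) - Real.log n := by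
    rw [← Real.log_div hn1.ne' hn0.ne']
    refine le_trans (le_of_eq ?_) (Real.one_sub_inv_le_log_of_pos (by positivity))
    push_cast
    field_simp
    ring
  rw [← Real.log_div hl'.ne' hl.ne']
  constructor
  · refine le_trans ?_ (Real.one_sub_inv_le_log_of_pos (by positivity))
    rw [inv_div, one_sub_div hl'.ne', ← div_div]
    gcongr
  · refine (Real.log_le_sub_one_of_pos (by positivity)).trans ?_
    rw [div_sub_one hl.ne', ← div_div]
    gcongr

lemma sum_Ioc_one_div_mul_log_bounds {m M : ℕ} (hm : 2 ≤ m) (hM : m ≤ M) :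
    Real.log (Real.log (M + 1 : ℕ)) - Real.log (Real.log (m + 1 : ℕ)) ≤
        ∑ n ∈ Finset.Ioc m M, 1 / (n * Real.log n) ∧
      ∑ n ∈ Finset.Ioc m M, 1 / (n * Real.log n) ≤
        Real.log (Real.log M) - Real.log (Real.log m) := by
  induction M, hM using Nat.le_induction with
  | base => simp
  | succ M hM ih =>
    rw [Finset.sum_Ioc_succ_top hM]
    have h1 := (log_log_succ_sub_bounds (hm.trans hM)).1
    have h2 := (log_log_succ_sub_bounds (show 2 ≤ M + 1 by omega)).2
    constructor <;> linarith [ih.1, ih.2]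

/-- The sum of `1 / (n log n)` over `exp A < n ≤ exp B` is close to `log B - log A`. -/
lemma abs_sum_Ioc_one_div_mul_log_sub_le {A B : ℝ} (hA : 1 ≤ A) (hAB : A ≤ B) :
    |∑ n ∈ Finset.Ioc ⌊Real.exp A⌋₊ ⌊Real.exp B⌋₊, 1 / (n * Real.log n) -
      (Real.log B - Real.log A)| ≤ 4 * Real.exp (-A) := by
  have he : 2 < Real.exp A :=
    lt_of_lt_of_le (by linarith [Real.exp_one_gt_d9]) (Real.exp_le_exp.2 hA)
  have key : ∀ D : ℝ, A ≤ D → 2 ≤ ⌊Real.exp D⌋₊ ∧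
      Real.log (Real.log ⌊Real.exp D⌋₊) ≤ Real.log D ∧
      Real.log D ≤ Real.log (Real.log (⌊Real.exp D⌋₊ + 1 : ℕ)) := fun D hD => by
    have heD : Real.exp A ≤ Real.exp D := Real.exp_le_exp.2 hD
    have h2 : 2 ≤ ⌊Real.exp D⌋₊ := Nat.le_floor (by push_cast; linarith)
    have h2' : (2 : ℝ) ≤ ⌊Real.exp D⌋₊ := by exact_mod_cast h2
    refine ⟨h2, Real.log_le_log (Real.log_pos (by linarith)) ?_,
      Real.log_le_log (by linarith) ?_⟩
    · rw [Real.log_le_iff_le_exp (by linarith)]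
      exact Nat.floor_le (Real.exp_pos _).le
    · rw [Real.le_log_iff_exp_le (by positivity)]
      push_cast
      exact (Nat.lt_floor_add_one _).le
  obtain ⟨m2, mA, mA'⟩ := key A le_rfl
  obtain ⟨M2, MB, MB'⟩ := key B hAB
  obtain ⟨hlow, hup⟩ := sum_Ioc_one_div_mul_log_bounds m2
    (Nat.floor_mono (Real.exp_le_exp.2 hAB))
  have hstep := (log_log_succ_sub_bounds m2).2
  have hm : Real.exp A / 2 ≤ ⌊Real.exp A⌋₊ := by
    linarith [Nat.lt_floor_add_one (Real.exp A)]
  have hlog : 1 / 2 ≤ Real.log ⌊Real.exp A⌋₊ := by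
    refine le_trans (by linarith [Real.log_two_gt_d9]) (Real.log_le_log two_pos ?_)
    exact_mod_cast m2
  have hg : 1 / (⌊Real.exp A⌋₊ * Real.log ⌊Real.exp A⌋₊) ≤ 4 * Real.exp (-A) := by
    calc _ ≤ 1 / (Real.exp A / 2 * (1 / 2)) := by gcongr
      _ = _ := by rw [Real.exp_neg]; field_simp; norm_num
  rw [abs_le]
  constructor <;> linarith

lemma mem_Ioc_floor_exp_iff {A B : ℝ} {n : ℕ} (hA : 0 ≤ A) :
    n ∈ Finset.Ioc ⌊Real.exp A⌋₊ ⌊Real.exp B⌋₊ ↔ A < Real.log n ∧ Real.log n ≤ B := by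
  rw [Finset.mem_Ioc, Nat.floor_lt (Real.exp_pos _).le, Nat.le_floor_iff (Real.exp_pos _).le]
  rcases Nat.eq_zero_or_pos n with rfl | hn
  · simp only [Nat.cast_zero, Real.log_zero]
    constructor
    · intro h; linarith [Real.exp_pos A, h.1]
    · intro h; linarith [h.1]
  · have hn' : (0 : ℝ) < n := by exact_mod_cast hn
    rw [Real.lt_log_iff_exp_lt hn', Real.log_le_iff_le_exp hn']

lemma sum_Ioc_le_sum_mul_smoothCutoff {F : ℕ → ℝ} (hF : ∀ n, 0 ≤ F n) {α β δ : ℝ} (hα : 0 ≤ α)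
    (hδ : 0 < δ) :
    ∑ n ∈ Finset.Ioc ⌊Real.exp (α + δ)⌋₊ ⌊Real.exp (β - δ)⌋₊, F n ≤
      ∑ n ∈ Finset.range (⌊Real.exp β⌋₊ + 1), F n * smoothCutoff α β δ (Real.log n) := by
  refine (Finset.sum_le_sum (g := fun n : ℕ => F n * smoothCutoff α β δ (Real.log n))
    fun n hn => ?_).trans (Finset.sum_le_sum_of_subset_of_nonneg (fun n hn => ?_) fun n _ _ => ?_)
  · rw [mem_Ioc_floor_exp_iff (by linarith)] at hn
    rw [smoothCutoff_eq_one hδ hn.1.le hn.2, mul_one]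
  · rw [Finset.mem_range, Nat.lt_succ_iff]
    exact (Finset.mem_Ioc.1 hn).2.trans (Nat.floor_mono (Real.exp_le_exp.2 (by linarith)))
  · exact mul_nonneg (hF n) (smoothCutoff_nonneg _ _ _ _)

lemma sum_mul_smoothCutoff_le_sum_Ioc {F : ℕ → ℝ} (hF : ∀ n, 0 ≤ F n) {α β δ : ℝ} (hα : 0 ≤ α)
    (hδ : 0 < δ) :
    ∑ n ∈ Finset.range (⌊Real.exp β⌋₊ + 1), F n * smoothCutoff α β δ (Real.log n) ≤
      ∑ n ∈ Finset.Ioc ⌊Real.exp α⌋₊ ⌊Real.exp β⌋₊, F n := by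
  have hsub : Finset.Ioc ⌊Real.exp α⌋₊ ⌊Real.exp β⌋₊ ⊆ Finset.range (⌊Real.exp β⌋₊ + 1) :=
    fun n hn => Finset.mem_range.2 (Nat.lt_succ_iff.2 (Finset.mem_Ioc.1 hn).2)
  rw [← Finset.sum_subset hsub fun n _ hn => ?_]
  · exact Finset.sum_le_sum fun n _ => mul_le_of_le_one_right (hF n) (smoothCutoff_le_one _ _ _ _)
  · rw [mem_Ioc_floor_exp_iff hα, not_and_or, not_lt, not_le] at hn
    rcases hn with hn | hn
    · rw [smoothCutoff_eq_zero_of_le β hδ hn, mul_zero]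
    · rw [smoothCutoff_eq_zero_of_ge α hδ hn.le, mul_zero]

lemma exists_sum_vonMangoldt_bounds (k : ℕ) :
    ∃ C : ℝ, 0 < C ∧ ∀ α β δ : ℝ, 1 ≤ α → α ≤ β → 0 < δ → δ ≤ 1 →
      ∑ n ∈ Finset.Ioc ⌊Real.exp (α + δ)⌋₊ ⌊Real.exp (β - δ)⌋₊,
          ArithmeticFunction.vonMangoldt n / (n * Real.log n) ≤
        ∑ n ∈ Finset.Ioc ⌊Real.exp α⌋₊ ⌊Real.exp β⌋₊, 1 / (n * Real.log n) +
          C * ((β - α) * ((α ^ (k + 1))⁻¹ * (δ ^ 2)⁻¹)) ∧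
      ∑ n ∈ Finset.Ioc ⌊Real.exp (α + δ)⌋₊ ⌊Real.exp (β - δ)⌋₊, 1 / (n * Real.log n) ≤
        ∑ n ∈ Finset.Ioc ⌊Real.exp α⌋₊ ⌊Real.exp β⌋₊,
          ArithmeticFunction.vonMangoldt n / (n * Real.log n) +
          C * ((β - α) * ((α ^ (k + 1))⁻¹ * (δ ^ 2)⁻¹)) := by
  obtain ⟨C, hC, h⟩ := exists_abs_sum_vonMangoldt_sub_one_mul_smoothCutoff_le k
  refine ⟨C, hC, fun α β δ hα hαβ hδ hδ1 => ?_⟩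
  have hM : ∀ n : ℕ, ⌊Real.exp β⌋₊ + 1 ≤ n → β ≤ Real.log n := fun n hn => by
    have hlt : Real.exp β < n := Nat.lt_of_floor_lt (Nat.lt_of_succ_le hn)
    rw [Real.le_log_iff_exp_le ((Real.exp_pos _).trans hlt)]
    exact hlt.le
  have hb := abs_le.1 (h α β δ hα hαβ hδ hδ1 _ hM)
  simp only [sub_div, sub_mul, Finset.sum_sub_distrib] at hb
  have hden : ∀ n : ℕ, (0 : ℝ) ≤ n * Real.log n := fun n =>
    mul_nonneg n.cast_nonneg (Real.log_natCast_nonneg n)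
  have hΛ : ∀ n : ℕ, 0 ≤ ArithmeticFunction.vonMangoldt n / (n * Real.log n) := fun n =>
    div_nonneg ArithmeticFunction.vonMangoldt_nonneg (hden n)
  have h1 : ∀ n : ℕ, 0 ≤ 1 / (n * Real.log n) := fun n => div_nonneg zero_le_one (hden n)
  have hα0 : 0 ≤ α := by linarith
  have a1 := sum_Ioc_le_sum_mul_smoothCutoff hΛ (β := β) hα0 hδ
  have a2 := sum_mul_smoothCutoff_le_sum_Ioc hΛ (β := β) hα0 hδ
  have a3 := sum_Ioc_le_sum_mul_smoothCutoff h1 (β := β) hα0 hδ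
  have a4 := sum_mul_smoothCutoff_le_sum_Ioc h1 (β := β) hα0 hδ
  constructor <;> linarith [hb.1, hb.2]

lemma log_sub_log_le_sub {a b : ℝ} (ha : 1 ≤ a) (hab : a ≤ b) :
    Real.log b - Real.log a ≤ b - a := by
  have ha0 : 0 < a := by linarith
  rw [← Real.log_div (by linarith) ha0.ne']
  refine (Real.log_le_sub_one_of_pos (div_pos (by linarith) ha0)).trans ?_
  rw [div_sub_one ha0.ne', div_le_iff₀ ha0]
  nlinarith

lemma exp_neg_le_factorial_mul_inv_pow (K : ℕ) {u A : ℝ} (hu : 0 < u) (hA : u / 2 ≤ A) :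
    Real.exp (-A) ≤ 2 ^ K * K.factorial * (u ^ K)⁻¹ := by
  have h := Real.pow_div_factorial_le_exp (u / 2) (by positivity) K
  have hfac : (0 : ℝ) < K.factorial := by exact_mod_cast K.factorial_pos
  calc Real.exp (-A) ≤ (Real.exp (u / 2))⁻¹ := by
        rw [← Real.exp_neg]
        exact Real.exp_le_exp.2 (by linarith)
    _ ≤ ((u / 2) ^ K / K.factorial)⁻¹ := inv_anti₀ (by positivity) h
    _ = _ := by rw [div_pow]; field_simp

lemma exists_abs_sum_vonMangoldt_sub_log_le {h : ℝ} (hh : 0 < h) {K : ℕ} (hK : K ≠ 0) :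
    ∃ C : ℝ, ∀ᶠ u : ℝ in atTop,
      |∑ n ∈ Finset.Ioc ⌊Real.exp u⌋₊ ⌊Real.exp (u + h)⌋₊,
          ArithmeticFunction.vonMangoldt n / (n * Real.log n) -
        (Real.log (u + h) - Real.log u)| ≤ C * (u ^ K)⁻¹ := by
  obtain ⟨C, hC, hb⟩ := exists_sum_vonMangoldt_bounds (3 * K)
  refine ⟨C * (h + 2) * 2 ^ (3 * K) + 4 * (2 ^ K * K.factorial) + 2, ?_⟩
  have hlim : Tendsto (fun u : ℝ => (u ^ K)⁻¹) atTop (nhds 0) :=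
    (tendsto_pow_atTop hK).inv_tendsto_atTop
  filter_upwards [eventually_ge_atTop 2, hlim.eventually_le_const (show (0 : ℝ) < h / 2 by linarith)]
    with u hu hδh
  have hu0 : 0 < u := by linarith
  have hδ1 : (u ^ K)⁻¹ ≤ 1 := inv_le_one_of_one_le₀ (one_le_pow₀ (by linarith))
  have hδ : 0 < (u ^ K)⁻¹ := by positivity
  have hexp : ∀ A, u / 2 ≤ A → 4 * Real.exp (-A) ≤ 4 * (2 ^ K * K.factorial) * (u ^ K)⁻¹ :=
    fun A hA => by linarith [exp_neg_le_factorial_mul_inv_pow K hu0 hA]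
  set δ := (u ^ K)⁻¹ with hδdef
  have herr : ∀ α l, u / 2 ≤ α → 0 ≤ l → l ≤ h + 2 →
      C * (l * ((α ^ (3 * K + 1))⁻¹ * (δ ^ 2)⁻¹)) ≤ C * (h + 2) * 2 ^ (3 * K) * δ := by
    intro α l hα hl hl'
    have hα0 : 0 < α := by linarith
    have hpow : (α ^ (3 * K + 1))⁻¹ ≤ 2 ^ (3 * K) * δ ^ 3 := by
      calc (α ^ (3 * K + 1))⁻¹ ≤ ((u / 2) ^ (3 * K))⁻¹ := by
            refine inv_anti₀ (by positivity) ?_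
            calc (u / 2) ^ (3 * K) ≤ α ^ (3 * K) := by gcongr
              _ ≤ α ^ (3 * K + 1) := pow_le_pow_right₀ (by linarith) (by omega)
        _ = 2 ^ (3 * K) * δ ^ 3 := by
            rw [hδdef, div_pow, inv_div, inv_pow, ← pow_mul, mul_comm K 3, div_eq_mul_inv]
    calc C * (l * ((α ^ (3 * K + 1))⁻¹ * (δ ^ 2)⁻¹))
        ≤ C * ((h + 2) * (2 ^ (3 * K) * δ ^ 3 * (δ ^ 2)⁻¹)) := by gcongr
      _ = _ := by field_simp
  have hup := (hb (u - δ) (u + h + δ) δ (by linarith) (by linarith) hδ hδ1).1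
  have hlow := (hb u (u + h) δ (by linarith) (by linarith) hδ hδ1).2
  rw [sub_add_cancel, add_sub_cancel_right] at hup
  have e1 := herr (u - δ) (u + h + δ - (u - δ)) (by linarith) (by linarith) (by linarith)
  have e2 := herr u (u + h - u) (by linarith) (by linarith) (by linarith)
  have g1 := abs_le.1 (abs_sum_Ioc_one_div_mul_log_sub_le (A := u - δ) (B := u + h + δ)
    (by linarith) (by linarith))
  have g2 := abs_le.1 (abs_sum_Ioc_one_div_mul_log_sub_le (A := u + δ) (B := u + h - δ)
    (by linarith) (by linarith))
  have x1 := hexp (u - δ) (by linarith)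
  have x2 := hexp (u + δ) (by linarith)
  have l1 := log_sub_log_le_sub (a := u + h) (b := u + h + δ) (by linarith) (by linarith)
  have l2 := log_sub_log_le_sub (a := u - δ) (b := u) (by linarith) (by linarith)
  have l3 := log_sub_log_le_sub (a := u) (b := u + δ) (by linarith) (by linarith)
  have l4 := log_sub_log_le_sub (a := u + h - δ) (b := u + h) (by linarith) (by linarith)
  rw [abs_le]
  constructor <;> linarith [g1.1, g1.2, g2.1, g2.2]

lemma primeSumIoc_exp_eq (u v : ℝ) :
    primeSumIoc (Real.exp u) (Real.exp v) =
      ∑ n ∈ (Finset.Ioc ⌊Real.exp u⌋₊ ⌊Real.exp v⌋₊).filter Nat.Prime,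
        ArithmeticFunction.vonMangoldt n / (n * Real.log n) := by
  rw [primeSumIoc]
  refine Finset.sum_congr ?_ fun n hn => ?_
  · ext n
    simp only [Finset.mem_filter, Finset.mem_range, Finset.mem_Ioc,
      Nat.floor_lt (Real.exp_pos u).le, Nat.le_floor_iff (Real.exp_pos v).le, Nat.lt_succ_iff]
    tauto
  · have hp : n.Prime := (Finset.mem_filter.1 hn).2
    have hlog : Real.log n ≠ 0 := (Real.log_pos (by exact_mod_cast hp.one_lt)).ne'
    have hn0 : (n : ℝ) ≠ 0 := by exact_mod_cast hp.ne_zero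
    rw [ArithmeticFunction.vonMangoldt_apply_prime hp]
    field_simp

/-- Prime powers contribute little to the von Mangoldt weighted sum. -/
lemma abs_sum_vonMangoldt_sub_primeSumIoc_le {u : ℝ} (hu : 1 ≤ u) (v : ℝ) :
    |∑ n ∈ Finset.Ioc ⌊Real.exp u⌋₊ ⌊Real.exp v⌋₊,
        ArithmeticFunction.vonMangoldt n / (n * Real.log n) -
      primeSumIoc (Real.exp u) (Real.exp v)| ≤
      (Chebyshev.psi (Real.exp v) - Chebyshev.theta (Real.exp v)) * Real.exp (-u) := by
  have hden : ∀ n : ℕ, (0 : ℝ) ≤ n * Real.log n := fun n =>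
    mul_nonneg n.cast_nonneg (Real.log_natCast_nonneg n)
  rw [primeSumIoc_exp_eq, ← Finset.sum_filter_add_sum_filter_not _ Nat.Prime,
    add_sub_cancel_left, abs_of_nonneg (Finset.sum_nonneg fun n _ =>
      div_nonneg ArithmeticFunction.vonMangoldt_nonneg (hden n)),
    Chebyshev.psi_sub_theta_eq_sum_not_prime, Finset.sum_mul]
  refine (Finset.sum_le_sum (g := fun n => ArithmeticFunction.vonMangoldt n * Real.exp (-u))
    fun n hn => ?_).trans (Finset.sum_le_sum_of_subset_of_nonneg
      (Finset.filter_subset_filter _ (Finset.Ioc_subset_Ioc_left (Nat.zero_le _)))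
      fun n _ _ => mul_nonneg ArithmeticFunction.vonMangoldt_nonneg (Real.exp_pos _).le)
  have hn' := (Finset.mem_filter.1 hn).1
  have hlog := (mem_Ioc_floor_exp_iff (by linarith)).1 hn'
  have hlt := (Nat.floor_lt (Real.exp_pos u).le).1 (Finset.mem_Ioc.1 hn').1
  rw [div_eq_mul_inv, Real.exp_neg]
  refine mul_le_mul_of_nonneg_left (inv_anti₀ (Real.exp_pos u) ?_)
    ArithmeticFunction.vonMangoldt_nonneg
  nlinarith [Real.exp_pos u]

lemma exists_abs_primeSumIoc_exp_sub_log_le {h : ℝ} (hh : 0 < h) {K : ℕ} (hK : K ≠ 0) :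
    ∃ C : ℝ, ∀ᶠ u : ℝ in atTop,
      |primeSumIoc (Real.exp u) (Real.exp (u + h)) - (Real.log (u + h) - Real.log u)| ≤
        C * (u ^ K)⁻¹ := by
  obtain ⟨C, hC⟩ := exists_abs_sum_vonMangoldt_sub_log_le hh hK
  obtain ⟨D, hD⟩ := Chebyshev.psi_sub_theta_le_mul_sqrt
  refine ⟨C + |D| * Real.exp (h / 2) * (2 ^ K * K.factorial), ?_⟩
  filter_upwards [hC, eventually_ge_atTop 1] with u hu hu1
  have h1 := abs_sum_vonMangoldt_sub_primeSumIoc_le hu1 (u + h)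
  have h2 := exp_neg_le_factorial_mul_inv_pow K (show 0 < u by linarith) le_rfl
  have h3 : (Chebyshev.psi (Real.exp (u + h)) - Chebyshev.theta (Real.exp (u + h))) *
      Real.exp (-u) ≤ |D| * Real.exp (h / 2) * Real.exp (-(u / 2)) := by
    calc _ ≤ |D| * √(Real.exp (u + h)) * Real.exp (-u) := by
          gcongr
          exact (hD _).trans (by gcongr; exact le_abs_self D)
      _ = _ := by
          rw [Real.sqrt_eq_rpow, ← Real.exp_mul, mul_assoc, mul_assoc, ← Real.exp_add,
            ← Real.exp_add]
          ring_nf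
  have h4 : |D| * Real.exp (h / 2) * Real.exp (-(u / 2)) ≤
      |D| * Real.exp (h / 2) * (2 ^ K * K.factorial * (u ^ K)⁻¹) := by gcongr
  rw [abs_sub_comm] at h1
  refine (abs_sub_le _ _ _).trans ((add_le_add (h1.trans (h3.trans h4)) hu).trans (le_of_eq ?_))
  ring

lemma abs_log_one_add_inv_sub_sum_le {x : ℝ} (hx : 2 ≤ x) (N : ℕ) :
    |Real.log (1 + x⁻¹) - ∑ n ∈ Finset.Icc 1 N, (-1 : ℝ) ^ (n - 1) / (n * x ^ n)| ≤
      2 * (x ^ (N + 1))⁻¹ := by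
  have hx0 : 0 < x := by linarith
  have habs : |-x⁻¹| = x⁻¹ := by rw [abs_neg, abs_of_pos (by positivity)]
  have hinv : x⁻¹ ≤ 1 / 2 := by rw [one_div]; exact inv_anti₀ two_pos hx
  have h := Real.abs_log_sub_add_sum_range_le (x := -x⁻¹) (by rw [habs]; linarith) N
  rw [habs, sub_neg_eq_add] at h
  have hsum : ∑ n ∈ Finset.Icc 1 N, (-1 : ℝ) ^ (n - 1) / (n * x ^ n) =
      -∑ i ∈ Finset.range N, (-x⁻¹) ^ (i + 1) / ((i : ℝ) + 1) := by
    clear h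
    induction N with
    | zero => simp
    | succ N ih =>
      rw [Finset.sum_Icc_succ_top (by omega), ih, Finset.sum_range_succ, neg_add, neg_pow x⁻¹,
        Nat.add_sub_cancel, pow_succ (-1 : ℝ), inv_pow]
      push_cast
      field_simp
  rw [hsum, sub_neg_eq_add, add_comm]
  refine h.trans ?_
  rw [div_le_iff₀ (by linarith), inv_pow]
  have : 0 < (x ^ (N + 1))⁻¹ := by positivity
  nlinarith

/-- For every real `a > 1` and every integer `N ≥ 1`,
`(∑_{a^x < p ≤ a^{x+1}} 1/p) − ∑_{n=1}^{N} (−1)^{n−1}/(n·x^n)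
  ∼ (−1)^N/((N+1)·x^{N+1})` as `x → ∞`. -/
theorem primeSum_Ioc_pow_asymptotic_expansion (a : ℝ) (ha : 1 < a) (N : ℕ) (hN : 1 ≤ N) :
    Tendsto (fun x : ℝ =>
        (primeSumIoc (a ^ x) (a ^ (x + 1))
            - ∑ n ∈ Finset.Icc 1 N, (-1 : ℝ) ^ (n - 1) / ((n : ℝ) * x ^ n))
          / ((-1 : ℝ) ^ N / (((N : ℝ) + 1) * x ^ (N + 1))))
      atTop (nhds 1) := by
  have ha0 : 0 < a := by linarith
  have hl : 0 < Real.log a := Real.log_pos ha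
  obtain ⟨C, hC⟩ := exists_abs_primeSumIoc_exp_sub_log_le hl (K := N + 2) (by omega)
  have hlim : Tendsto (fun x : ℝ =>
      (C * (Real.log a ^ (N + 2))⁻¹ + 2) * ((N : ℝ) + 1) * x⁻¹) atTop (nhds 0) := by
    simpa using tendsto_inv_atTop_zero.const_mul
      ((C * (Real.log a ^ (N + 2))⁻¹ + 2) * ((N : ℝ) + 1))
  refine tendsto_iff_norm_sub_tendsto_zero.2 (squeeze_zero' (Eventually.of_forall fun _ =>
    norm_nonneg _) ?_ hlim)
  filter_upwards [(tendsto_id.const_mul_atTop hl).eventually hC, eventually_ge_atTop 2]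
    with x hx hx2
  have hx0 : 0 < x := by linarith
  have e1 : Real.exp (Real.log a * x) = a ^ x := (Real.rpow_def_of_pos ha0 x).symm
  have e2 : Real.exp (Real.log a * x + Real.log a) = a ^ (x + 1) := by
    rw [Real.rpow_def_of_pos ha0, mul_add, mul_one]
  have e3 : Real.log (Real.log a * x + Real.log a) - Real.log (Real.log a * x) =
      Real.log (1 + x⁻¹) := by
    rw [← Real.log_div (by positivity) (by positivity)]
    congr 1
    field_simp
  simp only [id] at hx
  rw [e1, e2, e3, mul_pow, mul_inv] at hx
  have hlog := abs_log_one_add_inv_sub_sum_le hx2 (N + 1)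
  rw [Finset.sum_Icc_succ_top (by omega), Nat.add_sub_cancel] at hlog
  push_cast at hlog
  set S := ∑ n ∈ Finset.Icc 1 N, (-1 : ℝ) ^ (n - 1) / ((n : ℝ) * x ^ n) with hS
  set T := (-1 : ℝ) ^ N / (((N : ℝ) + 1) * x ^ (N + 1)) with hT
  have hTabs : |T| = (((N : ℝ) + 1) * x ^ (N + 1))⁻¹ := by
    rw [hT, abs_div, abs_pow, abs_neg, abs_one, one_pow, abs_of_pos (by positivity), one_div]
  have hT0 : T ≠ 0 := by
    rw [← abs_pos, hTabs]
    positivity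
  have hmain : |primeSumIoc (a ^ x) (a ^ (x + 1)) - S - T| ≤
      (C * (Real.log a ^ (N + 2))⁻¹ + 2) * (x ^ (N + 2))⁻¹ := by
    have := abs_add_le (primeSumIoc (a ^ x) (a ^ (x + 1)) - Real.log (1 + x⁻¹))
      (Real.log (1 + x⁻¹) - (S + T))
    rw [show primeSumIoc (a ^ x) (a ^ (x + 1)) - Real.log (1 + x⁻¹) +
      (Real.log (1 + x⁻¹) - (S + T)) = primeSumIoc (a ^ x) (a ^ (x + 1)) - S - T by ring] at this
    linarith
  rw [div_sub_one hT0, Real.norm_eq_abs, abs_div, hTabs, div_inv_eq_mul]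
  calc _ ≤ (C * (Real.log a ^ (N + 2))⁻¹ + 2) * (x ^ (N + 2))⁻¹ *
        (((N : ℝ) + 1) * x ^ (N + 1)) := by gcongr
    _ = _ := by
      rw [pow_succ x (N + 1)]
      field_simp
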